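/- Let f_θ : ℝ^D → ℝ^O be a fully-connected network of depth L in the ReLU-MLP setting with hidden width n, and fix inputs x₁, x₂ in a compact set. Let Θ_θ(x₁,x₂) ∈ ℝ^{O×O} be the empirical NTK and Θ̂_θ(x₁,x₂) ∈ ℝ the pseudo-NTK. Then for every δ > 0 there exist n₀ and a constant C such that for all n > n₀, with probability at least 1 − δ over the random initialization, |λ_max(Θ̂_θ(x₁,x₂) ⊗ I_O) − λ_max(Θ_θ(x₁,x₂))| / λ_max(Θ_θ(x₁,x₂)) ≤ C·n^{−1/2}. -/

import Mathlib

open MeasureTheory ProbabilityTheory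

noncomputable section

/-- The ReLU activation. -/
def relu (t : ℝ) : ℝ := max t 0

/-- Parameter space of an `L`-layer fully-connected network with widths `w`:
`w 0` is the input dimension and `w L` the output dimension. -/
abbrev Params (L : ℕ) (w : ℕ → ℕ) : Type :=
  (l : Fin L) → Fin (w (l.val + 1)) → Fin (w l.val) → ℝ

/-- Extend a finite family of weight matrices to all layer indices (zero beyond `L`). -/
def extParams {L : ℕ} {w : ℕ → ℕ} (θ : Params L w) (l : ℕ) :
    Fin (w (l + 1)) → Fin (w l) → ℝ :=
  if h : l < L then θ ⟨l, h⟩ else 0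

/-- Post-activations of layer `l` (ReLU applied coordinatewise); `layerOut w θ 0 x = x`. -/
def layerOut (w : ℕ → ℕ) (θ : (l : ℕ) → Fin (w (l + 1)) → Fin (w l) → ℝ) :
    (l : ℕ) → (Fin (w 0) → ℝ) → Fin (w l) → ℝ
  | 0, x => x
  | l + 1, x => fun i => relu (∑ j, θ l i j * layerOut w θ l x j)

/-- Network output: a linear read-out layer on top of `L - 1` ReLU layers. -/
def netOut (w : ℕ → ℕ) (θ : (l : ℕ) → Fin (w (l + 1)) → Fin (w l) → ℝ) :
    (L : ℕ) → (Fin (w 0) → ℝ) → Fin (w L) → ℝ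
  | 0, x => x
  | L + 1, x => fun i => ∑ j, θ L i j * layerOut w θ L x j

/-- The fully-connected network, as a function of its parameters. -/
def fnet (L : ℕ) (w : ℕ → ℕ) (θ : Params L w) (x : Fin (w 0) → ℝ) : Fin (w L) → ℝ :=
  netOut w (extParams θ) L x

/-- Partial derivative of a scalar function of the parameters with respect to the
weight with coordinates `(l, i, j)` (defined via the Fréchet derivative, which exists
almost surely for the networks considered here). -/
def pderiv {L : ℕ} {w : ℕ → ℕ} (F : Params L w → ℝ) (θ : Params L w)
    (l : Fin L) (i : Fin (w (l.val + 1))) (j : Fin (w l.val)) : ℝ :=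
  fderiv ℝ F θ (Pi.single l (Pi.single i (Pi.single j (1 : ℝ))))

/-- The empirical NTK `Θ_θ(x₁, x₂) = J_θ(f_θ(x₁)) J_θ(f_θ(x₂))ᵀ ∈ ℝ^{O×O}`. -/
def eNTK (L : ℕ) (w : ℕ → ℕ) (θ : Params L w) (x₁ x₂ : Fin (w 0) → ℝ) :
    Matrix (Fin (w L)) (Fin (w L)) ℝ := fun i₁ i₂ =>
  ∑ l : Fin L, ∑ a : Fin (w (l.val + 1)), ∑ b : Fin (w l.val),
    pderiv (fun θ' => fnet L w θ' x₁ i₁) θ l a b *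
      pderiv (fun θ' => fnet L w θ' x₂ i₂) θ l a b

/-- The pseudo-NTK ("sum of logits"): the scalar kernel
`⟨∇_θ (1/√O) ∑ᵢ f^{(i)}_θ(x₁), ∇_θ (1/√O) ∑ᵢ f^{(i)}_θ(x₂)⟩`. -/
def pNTK (L : ℕ) (w : ℕ → ℕ) (θ : Params L w) (x₁ x₂ : Fin (w 0) → ℝ) : ℝ :=
  ∑ l : Fin L, ∑ a : Fin (w (l.val + 1)), ∑ b : Fin (w l.val),
    pderiv (fun θ' => (Real.sqrt (w L))⁻¹ * ∑ i, fnet L w θ' x₁ i) θ l a b *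
      pderiv (fun θ' => (Real.sqrt (w L))⁻¹ * ∑ i, fnet L w θ' x₂ i) θ l a b

/-- He ("fan-in") initialization: all weights independent, `W^{(l)}_{ij} ~ N(0, 1/n_{l-1})`. -/
def initMeasure (L : ℕ) (w : ℕ → ℕ) : Measure (Params L w) :=
  Measure.pi fun l => Measure.pi fun _ => Measure.pi fun _ =>
    gaussianReal 0 ((w l.val : NNReal))⁻¹

/-- Widths of the ReLU-MLP: input dimension `D`, hidden layers of width `n`, output `O`. -/
def widths (D n O L : ℕ) : ℕ → ℕ
  | 0 => D
  | l + 1 => if l + 1 < L then n else O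

/-- Frobenius norm of a real matrix. -/
def frobNorm {m k : Type*} [Fintype m] [Fintype k] (M : Matrix m k ℝ) : ℝ :=
  Real.sqrt (∑ i, ∑ j, (M i j) ^ 2)


/-- Largest (real) eigenvalue of a square matrix, as the supremum of its real spectrum. -/
def lambdaMax {k : Type*} [Fintype k] [DecidableEq k] (M : Matrix k k ℝ) : ℝ :=
  sSup (spectrum ℝ M)

/-- The law of a random matrix with independent centred Gaussian entries of variance `v`. -/
abbrev gaussianMatrix (ι κ : Type*) [Fintype ι] [Fintype κ] (v : NNReal) :
    Measure (ι → κ → ℝ) :=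
  Measure.pi fun _ => Measure.pi fun _ => gaussianReal 0 v

/-- The linear form on matrices with coefficients `c`. -/
def matLin {ι κ : Type*} [Fintype ι] [Fintype κ] (c W : ι → κ → ℝ) : ℝ :=
  ∑ i, ∑ k, c i k * W i k

section GaussianMatrix

variable {ι κ : Type*} [Fintype ι] [Fintype κ] {v : NNReal}

theorem isGaussian_pi {E : ι → Type*} [∀ i, NormedAddCommGroup (E i)] [∀ i, NormedSpace ℝ (E i)]
    [∀ i, MeasurableSpace (E i)] [∀ i, BorelSpace (E i)] [∀ i, SecondCountableTopology (E i)]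
    [∀ i, CompleteSpace (E i)]
    (μ : ∀ i, Measure (E i)) [∀ i, IsGaussian (μ i)] : IsGaussian (Measure.pi μ) := by
  have h : HasGaussianLaw (fun ω : ∀ i, E i => fun i => ω i) (Measure.pi μ) := by
    refine iIndepFun.hasGaussianLaw (X := fun i (ω : ∀ i, E i) => ω i) (fun i => ?_)
      (iIndepFun_pi (X := fun i (x : E i) => x) fun i => aemeasurable_id')
    refine ⟨?_⟩
    rw [(measurePreserving_eval μ i).map_eq]
    infer_instance
  have := h.isGaussian_map
  rwa [Measure.map_id'] at this

instance : IsGaussian (Measure.pi fun _ : κ => gaussianReal 0 v) := isGaussian_pi _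

instance : IsGaussian (gaussianMatrix ι κ v) := isGaussian_pi _

theorem measurable_matLin (c : ι → κ → ℝ) : Measurable (matLin c) := by
  unfold matLin; fun_prop

theorem hasGaussianLaw_matLin (c : ι → κ → ℝ) :
    HasGaussianLaw (matLin c) (gaussianMatrix ι κ v) := by
  have h := (IsGaussian.hasGaussianLaw_id (μ := gaussianMatrix ι κ v)).map
    (∑ i, ∑ k, c i k • ((ContinuousLinearMap.proj (R := ℝ) (φ := fun _ : κ => ℝ) k).comp
      (ContinuousLinearMap.proj (R := ℝ) (φ := fun _ : ι => κ → ℝ) i)))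
  have e : matLin c = (∑ i, ∑ k, c i k • ((ContinuousLinearMap.proj (R := ℝ)
      (φ := fun _ : κ => ℝ) k).comp (ContinuousLinearMap.proj (R := ℝ)
      (φ := fun _ : ι => κ → ℝ) i)) : (ι → κ → ℝ) →L[ℝ] ℝ) ∘ id := by
    ext W
    simp [matLin]
  rw [e]
  exact h

theorem measurable_rowLin (c : κ → ℝ) : Measurable fun w : κ → ℝ => ∑ k, c k * w k := by
  fun_prop

theorem memLp_matLin (c : ι → κ → ℝ) {p : ENNReal} (hp : p ≠ ⊤) :
    MemLp (matLin c) p (gaussianMatrix ι κ v) := (hasGaussianLaw_matLin c).memLp hp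

theorem memLp_rowLin (c : κ → ℝ) {p : ENNReal} (hp : p ≠ ⊤) :
    MemLp (fun w => ∑ k, c k * w k) p (Measure.pi fun _ : κ => gaussianReal 0 v) := by
  refine memLp_finsetSum _ fun k _ => MemLp.const_mul ?_ _
  exact (memLp_id_gaussianReal' p hp).comp_measurePreserving (measurePreserving_eval _ k)

theorem map_rowLin (c : κ → ℝ) :
    (Measure.pi fun _ : κ => gaussianReal 0 v).map (fun w => ∑ k, c k * w k) =
      gaussianReal 0 (v * (∑ k, c k ^ 2).toNNReal) := by
  have h : HasGaussianLaw (fun w => ∑ k, c k * w k)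
      (Measure.pi fun _ : κ => gaussianReal 0 v) := by
    have h := (IsGaussian.hasGaussianLaw_id (μ := Measure.pi fun _ : κ => gaussianReal 0 v)).map
      (∑ k, c k • ((ContinuousLinearMap.proj (R := ℝ) (φ := fun _ : κ => ℝ) k)))
    have e : (fun w : κ → ℝ => ∑ k, c k * w k) = (∑ k, c k • (ContinuousLinearMap.proj (R := ℝ)
        (φ := fun _ : κ => ℝ) k) : (κ → ℝ) →L[ℝ] ℝ) ∘ id := by
      ext W
      simp
    rw [e]
    exact h
  rw [h.map_eq_gaussianReal]
  have h1 : ∫ w, (∑ k, c k * w k) ∂(Measure.pi fun _ : κ => gaussianReal 0 v) = 0 := by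
    rw [integral_finsetSum]
    · refine Finset.sum_eq_zero fun k _ => ?_
      rw [integral_const_mul, integral_comp_eval (μ := fun _ : κ => gaussianReal 0 v) (i := k)
        (f := fun x => x) (by fun_prop)]
      simp
    · intro k _
      refine Integrable.const_mul ?_ _
      exact memLp_one_iff_integrable.1 ((memLp_id_gaussianReal' 1 (by simp)).comp_measurePreserving
        (measurePreserving_eval _ k))
  have h2 : Var[fun w => ∑ k, c k * w k; Measure.pi fun _ : κ => gaussianReal 0 v]
      = v * ∑ k, c k ^ 2 := by
    have := variance_sum_pi (μ := fun _ : κ => gaussianReal 0 v) (X := fun k x => c k * x)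
      (fun k => (memLp_id_gaussianReal' 2 (by simp)).const_mul _)
    have e : (∑ k, fun w : κ → ℝ => c k * w k) = fun w => ∑ k, c k * w k := by
      ext w; simp
    rw [e] at this
    rw [this, Finset.mul_sum]
    refine Finset.sum_congr rfl fun k _ => ?_
    rw [variance_const_mul, variance_fun_id_gaussianReal]
    ring
  rw [h1, h2, Real.toNNReal_mul (by positivity), Real.toNNReal_coe]

theorem map_matLin (c : ι → κ → ℝ) :
    (gaussianMatrix ι κ v).map (matLin c) =
      gaussianReal 0 (v * (∑ i, ∑ k, c i k ^ 2).toNNReal) := by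
  rw [(hasGaussianLaw_matLin c).map_eq_gaussianReal]
  have hrow : ∀ i, ∫ w, (∑ k, c i k * w k) ∂(Measure.pi fun _ : κ => gaussianReal 0 v) = 0 := by
    intro i
    have := integral_map (μ := Measure.pi fun _ : κ => gaussianReal 0 v)
      (φ := fun w => ∑ k, c i k * w k) (f := fun x : ℝ => x) (measurable_rowLin _).aemeasurable (by fun_prop)
    rw [← this, map_rowLin]
    simp
  have hvar : ∀ i, Var[fun w => ∑ k, c i k * w k; Measure.pi fun _ : κ => gaussianReal 0 v]
      = v * ∑ k, c i k ^ 2 := by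
    intro i
    have := variance_map (μ := Measure.pi fun _ : κ => gaussianReal 0 v)
      (Y := fun w => ∑ k, c i k * w k) (X := fun x : ℝ => x) (by fun_prop)
      (measurable_rowLin _).aemeasurable
    rw [map_rowLin, variance_fun_id_gaussianReal] at this
    rw [show (fun w => ∑ k, c i k * w k) = (fun x : ℝ => x) ∘ (fun w : κ → ℝ => ∑ k, c i k * w k)
      from rfl, ← this, NNReal.coe_mul, Real.coe_toNNReal _ (by positivity)]
  have h1 : ∫ W, matLin c W ∂(gaussianMatrix ι κ v) = 0 := by
    unfold matLin
    rw [integral_finsetSum]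
    · refine Finset.sum_eq_zero fun i _ => ?_
      rw [integral_comp_eval (μ := fun _ : ι => Measure.pi fun _ : κ => gaussianReal 0 v) (i := i)
        (f := fun w => ∑ k, c i k * w k) (measurable_rowLin _).aestronglyMeasurable]
      exact hrow i
    · intro i _
      exact memLp_one_iff_integrable.1 ((memLp_rowLin (c i) (by simp)).comp_measurePreserving
        (measurePreserving_eval (fun _ : ι => Measure.pi fun _ : κ => gaussianReal 0 v) i))
  have h2 : Var[matLin c; gaussianMatrix ι κ v] = v * ∑ i, ∑ k, c i k ^ 2 := by
    have := variance_sum_pi (μ := fun _ : ι => Measure.pi fun _ : κ => gaussianReal 0 v)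
      (X := fun i w => ∑ k, c i k * w k) (fun i => memLp_rowLin (c i) (by simp))
    have e : (∑ i, fun W : ι → κ → ℝ => ∑ k, c i k * W i k) = matLin c := by
      ext w; simp [matLin]
    rw [e] at this
    rw [this, Finset.mul_sum]
    exact Finset.sum_congr rfl fun i _ => hvar i
  rw [h1, h2, Real.toNNReal_mul (by positivity), Real.toNNReal_coe]

theorem integral_pow_four_gaussianReal (v : NNReal) :
    ∫ x, x ^ 4 ∂(gaussianReal 0 v) = 3 * (v : ℝ) ^ 2 := by
  have h := iteratedDeriv_mgf_zero (X := id) (μ := gaussianReal 0 v)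
    (by simp [integrableExpSet_id_gaussianReal]) 4
  rw [mgf_id_gaussianReal] at h
  change _ = ∫ x, x ^ 4 ∂(gaussianReal 0 v) at h
  rw [← h]
  have key : ∀ (a b c d e : ℝ), deriv (fun t : ℝ => (a + b * t + c * t ^ 2 + d * t ^ 3 + e * t ^ 4)
      * Real.exp (0 * t + v * t ^ 2 / 2)) =
      fun t => ((b + 2 * c * t + 3 * d * t ^ 2 + 4 * e * t ^ 3)
        + v * t * (a + b * t + c * t ^ 2 + d * t ^ 3 + e * t ^ 4))
        * Real.exp (0 * t + v * t ^ 2 / 2) := by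
    intro a b c d e
    ext t
    have h1 : HasDerivAt (fun t : ℝ => a + b * t + c * t ^ 2 + d * t ^ 3 + e * t ^ 4)
        (b + 2 * c * t + 3 * d * t ^ 2 + 4 * e * t ^ 3) t := by
      have := ((((hasDerivAt_id' t).const_mul b).const_add a).fun_add
        ((hasDerivAt_pow 2 t).const_mul c)).fun_add ((hasDerivAt_pow 3 t).const_mul d) |>.fun_add
        ((hasDerivAt_pow 4 t).const_mul e)
      exact this.congr_deriv (by push_cast; ring)
    have h2 : HasDerivAt (fun t : ℝ => Real.exp (0 * t + v * t ^ 2 / 2))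
        (Real.exp (0 * t + v * t ^ 2 / 2) * (v * t)) t := by
      have := (((hasDerivAt_id' t).const_mul 0).fun_add
        (((hasDerivAt_pow 2 t).const_mul (v : ℝ)).div_const 2)).exp
      exact this.congr_deriv (by push_cast; ring)
    rw [(h1.fun_mul h2).deriv]
    ring
  have e0 : (fun t : ℝ => Real.exp (0 * t + v * t ^ 2 / 2)) =
      fun t => (1 + 0 * t + 0 * t ^ 2 + 0 * t ^ 3 + 0 * t ^ 4)
        * Real.exp (0 * t + v * t ^ 2 / 2) := by
    ext t; ring
  simp only [iteratedDeriv_succ, iteratedDeriv_zero]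
  rw [e0, key]
  rw [show (fun t : ℝ => ((0 + 2 * 0 * t + 3 * 0 * t ^ 2 + 4 * 0 * t ^ 3)
        + v * t * (1 + 0 * t + 0 * t ^ 2 + 0 * t ^ 3 + 0 * t ^ 4))
        * Real.exp (0 * t + v * t ^ 2 / 2)) = fun t => (0 + v * t + 0 * t ^ 2 + 0 * t ^ 3
        + 0 * t ^ 4) * Real.exp (0 * t + v * t ^ 2 / 2) by ext t; ring, key]
  rw [show (fun t : ℝ => (((v : ℝ) + 2 * 0 * t + 3 * 0 * t ^ 2 + 4 * 0 * t ^ 3)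
        + v * t * (0 + v * t + 0 * t ^ 2 + 0 * t ^ 3 + 0 * t ^ 4))
        * Real.exp (0 * t + v * t ^ 2 / 2)) = fun t => (v + 0 * t + v ^ 2 * t ^ 2 + 0 * t ^ 3
        + 0 * t ^ 4) * Real.exp (0 * t + v * t ^ 2 / 2) by ext t; ring, key]
  rw [show (fun t : ℝ => ((0 + 2 * (v : ℝ) ^ 2 * t + 3 * 0 * t ^ 2 + 4 * 0 * t ^ 3)
        + v * t * (v + 0 * t + v ^ 2 * t ^ 2 + 0 * t ^ 3 + 0 * t ^ 4))
        * Real.exp (0 * t + v * t ^ 2 / 2)) = fun t => (0 + 3 * v ^ 2 * t + 0 * t ^ 2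
        + v ^ 3 * t ^ 3 + 0 * t ^ 4) * Real.exp (0 * t + v * t ^ 2 / 2) by ext t; ring, key]
  simp

/-- The Euclidean inner product of two matrices. -/
def matDot (c d : ι → κ → ℝ) : ℝ := ∑ i, ∑ k, c i k * d i k

theorem integral_matLin_pow_four (c : ι → κ → ℝ) :
    ∫ W, matLin c W ^ 4 ∂(gaussianMatrix ι κ v) = 3 * (v : ℝ) ^ 2 * matDot c c ^ 2 := by
  have := integral_map (μ := gaussianMatrix ι κ v) (φ := matLin c) (f := fun x : ℝ => x ^ 4)
    (measurable_matLin c).aemeasurable (by fun_prop)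
  rw [← this, map_matLin, integral_pow_four_gaussianReal, NNReal.coe_mul,
    Real.coe_toNNReal _ (by positivity)]
  simp only [matDot, ← pow_two]
  ring

theorem matLin_add (c d W : ι → κ → ℝ) : matLin (c + d) W = matLin c W + matLin d W := by
  simp [matLin, add_mul, Finset.sum_add_distrib]

theorem matLin_sub (c d W : ι → κ → ℝ) : matLin (c - d) W = matLin c W - matLin d W := by
  simp [matLin, sub_mul, Finset.sum_sub_distrib]

theorem matDot_add_left (c d e : ι → κ → ℝ) : matDot (c + d) e = matDot c e + matDot d e :=
  matLin_add c d e

theorem matDot_sub_left (c d e : ι → κ → ℝ) : matDot (c - d) e = matDot c e - matDot d e :=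
  matLin_sub c d e

theorem matDot_comm (c d : ι → κ → ℝ) : matDot c d = matDot d c := by
  simp [matDot, mul_comm]

theorem matDot_add_right (c d e : ι → κ → ℝ) : matDot e (c + d) = matDot e c + matDot e d := by
  rw [matDot_comm, matDot_add_left, matDot_comm c, matDot_comm d]

theorem matDot_sub_right (c d e : ι → κ → ℝ) : matDot e (c - d) = matDot e c - matDot e d := by
  rw [matDot_comm, matDot_sub_left, matDot_comm c, matDot_comm d]

theorem integrable_matLin_pow_four (c : ι → κ → ℝ) :
    Integrable (fun W => matLin c W ^ 4) (gaussianMatrix ι κ v) := by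
  have := (memLp_matLin (v := v) c (p := 4) (by simp)).integrable_norm_pow (p := 4) (by simp)
  refine this.congr (Filter.Eventually.of_forall fun W => ?_)
  simp only [Real.norm_eq_abs]
  exact Even.pow_abs (by decide) _

theorem mul_four_polarization (a b c d : ℝ) : a * b * c * d =
    (1 / 192) * ((a + b + c + d) ^ 4 - (a + b + c - d) ^ 4 - (a + b - c + d) ^ 4
      + (a + b - c - d) ^ 4 - (a - b + c + d) ^ 4 + (a - b + c - d) ^ 4 + (a - b - c + d) ^ 4
      - (a - b - c - d) ^ 4) := by
  ring

theorem integrable_matLin_mul_four (a b c d : ι → κ → ℝ) :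
    Integrable (fun W => matLin a W * matLin b W * matLin c W * matLin d W)
      (gaussianMatrix ι κ v) := by
  simp only [mul_four_polarization, ← matLin_add, ← matLin_sub]
  refine Integrable.const_mul ?_ _
  exact ((((((((integrable_matLin_pow_four _).sub (integrable_matLin_pow_four _)).sub
    (integrable_matLin_pow_four _)).add (integrable_matLin_pow_four _)).sub
    (integrable_matLin_pow_four _)).add (integrable_matLin_pow_four _)).add
    (integrable_matLin_pow_four _)).sub (integrable_matLin_pow_four _))

/-- The Isserlis formula for four linear forms of a Gaussian matrix. -/
theorem integral_matLin_mul_four (a b c d : ι → κ → ℝ) :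
    ∫ W, matLin a W * matLin b W * matLin c W * matLin d W ∂(gaussianMatrix ι κ v) =
      (v : ℝ) ^ 2 * (matDot a b * matDot c d + matDot a c * matDot b d
        + matDot a d * matDot b c) := by
  have I := fun c : ι → κ → ℝ => integrable_matLin_pow_four (v := v) c
  have e : (fun W => matLin a W * matLin b W * matLin c W * matLin d W) = fun W =>
      (1 / 192) * (matLin (a + b + c + d) W ^ 4 - matLin (a + b + c - d) W ^ 4
      - matLin (a + b - c + d) W ^ 4 + matLin (a + b - c - d) W ^ 4
      - matLin (a - b + c + d) W ^ 4 + matLin (a - b + c - d) W ^ 4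
      + matLin (a - b - c + d) W ^ 4 - matLin (a - b - c - d) W ^ 4) := by
    ext W
    rw [mul_four_polarization]
    simp only [matLin_add, matLin_sub]
  rw [e, integral_const_mul, integral_sub _ (I _), integral_add _ (I _), integral_add _ (I _),
    integral_sub _ (I _), integral_add _ (I _), integral_sub _ (I _), integral_sub (I _) (I _)]
  · simp only [integral_matLin_pow_four, matDot_add_left, matDot_sub_left, matDot_add_right,
      matDot_sub_right]
    rw [matDot_comm b a, matDot_comm c a, matDot_comm d a, matDot_comm c b, matDot_comm d b,
      matDot_comm d c]
    ring
  · exact (I _).sub (I _)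
  · exact ((I _).sub (I _)).sub (I _)
  · exact (((I _).sub (I _)).sub (I _)).add (I _)
  · exact ((((I _).sub (I _)).sub (I _)).add (I _)).sub (I _)
  · exact (((((I _).sub (I _)).sub (I _)).add (I _)).sub (I _)).add (I _)
  · exact ((((((I _).sub (I _)).sub (I _)).add (I _)).sub (I _)).add (I _)).add (I _)

end GaussianMatrix

section GaussianEstimates

variable {ι κ : Type*} [Fintype ι] [Fintype κ] {v : NNReal}

theorem lintegral_ofReal_le_of_integral_le {Ω : Type*} [MeasurableSpace Ω] {μ : Measure Ω}
    {f : Ω → ℝ} (hf : Integrable f μ) (h0 : ∀ ω, 0 ≤ f ω) {C : ℝ} (hC : ∫ ω, f ω ∂μ ≤ C) :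
    ∫⁻ ω, ENNReal.ofReal (f ω) ∂μ ≤ ENNReal.ofReal C := by
  rw [← ofReal_integral_eq_lintegral_ofReal hf (Filter.Eventually.of_forall h0)]
  exact ENNReal.ofReal_le_ofReal hC

theorem integral_matLin_sq (c : ι → κ → ℝ) :
    ∫ W, matLin c W ^ 2 ∂(gaussianMatrix ι κ v) = v * matDot c c := by
  have := integral_map (μ := gaussianMatrix ι κ v) (φ := matLin c) (f := fun x : ℝ => x ^ 2)
    (measurable_matLin c).aemeasurable (by fun_prop)
  rw [← this, map_matLin]
  have h := variance_fun_id_gaussianReal (μ := 0) (v := v * (∑ i, ∑ k, c i k ^ 2).toNNReal)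
  rw [variance_of_integral_eq_zero (by fun_prop) (by simp)] at h
  rw [h, NNReal.coe_mul, Real.coe_toNNReal _ (by positivity)]
  simp only [matDot, ← pow_two]

theorem integrable_matLin_mul (a b : ι → κ → ℝ) :
    Integrable (fun W => matLin a W * matLin b W) (gaussianMatrix ι κ v) :=
  (memLp_matLin a (p := 2) (by simp)).integrable_mul (memLp_matLin b (p := 2) (by simp))

theorem integral_matLin_mul (a b : ι → κ → ℝ) :
    ∫ W, matLin a W * matLin b W ∂(gaussianMatrix ι κ v) = v * matDot a b := by
  have I := fun c : ι → κ → ℝ => (memLp_matLin (v := v) c (p := 2) (by simp)).integrable_sq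
  have e : (fun W => matLin a W * matLin b W) = fun W =>
      (1 / 4) * (matLin (a + b) W ^ 2 - matLin (a - b) W ^ 2) := by
    ext W
    simp only [matLin_add, matLin_sub]
    ring
  rw [e, integral_const_mul, integral_sub (I _) (I _)]
  simp only [integral_matLin_sq, matDot_add_left, matDot_sub_left, matDot_add_right,
      matDot_sub_right]
  rw [matDot_comm b a]
  ring

section Rows

variable [DecidableEq ι]

/-- The matrix whose only nonzero row is `c`, in position `i`. -/
def rowVec (i : ι) (c : κ → ℝ) : ι → κ → ℝ := Pi.single i c

theorem matLin_rowVec (i : ι) (c : κ → ℝ) (W : ι → κ → ℝ) :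
    matLin (rowVec i c) W = ∑ k, c k * W i k := by
  unfold matLin rowVec
  rw [Finset.sum_eq_single i]
  · simp
  · intro j _ hj
    simp [Pi.single_eq_of_ne hj]
  · simp

theorem matDot_rowVec (i j : ι) (c d : κ → ℝ) :
    matDot (rowVec i c) (rowVec j d) = if i = j then ∑ k, c k * d k else 0 := by
  change matLin (rowVec i c) (rowVec j d) = _
  rw [matLin_rowVec]
  unfold rowVec
  by_cases h : i = j
  · subst h; simp
  · simp [h]

theorem integrable_row_sq_mul_row_sq (i j : ι) (x y : κ → ℝ) :
    Integrable (fun W : ι → κ → ℝ => (∑ k, W i k * x k) ^ 2 * (∑ k, W j k * y k) ^ 2)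
      (gaussianMatrix ι κ v) := by
  refine (integrable_matLin_mul_four (rowVec i x) (rowVec i x) (rowVec j y) (rowVec j y)).congr
    (Filter.Eventually.of_forall fun W => ?_)
  simp only [matLin_rowVec, mul_comm]
  ring

theorem integral_row_sq_mul_row_sq_le (i j : ι) (x y : κ → ℝ) :
    ∫ W, (∑ k, W i k * x k) ^ 2 * (∑ k, W j k * y k) ^ 2 ∂(gaussianMatrix ι κ v) ≤
      3 * (v : ℝ) ^ 2 * (∑ k, x k ^ 2) * (∑ k, y k ^ 2) := by
  have h := integral_matLin_mul_four (v := v) (rowVec i x) (rowVec i x) (rowVec j y) (rowVec j y)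
  have e : (fun W : ι → κ → ℝ => (∑ k, W i k * x k) ^ 2 * (∑ k, W j k * y k) ^ 2) = fun W =>
    matLin (rowVec i x) W * matLin (rowVec i x) W * matLin (rowVec j y) W
      * matLin (rowVec j y) W := by
    ext W
    simp only [matLin_rowVec, mul_comm (W _ _)]
    ring
  rw [e, h]
  simp only [matDot_rowVec, if_true]
  have cs := Finset.sum_mul_sq_le_sq_mul_sq Finset.univ x y
  have : (if i = j then ∑ k, x k * y k else 0) ^ 2 ≤ (∑ k, x k ^ 2) * (∑ k, y k ^ 2) := by
    split_ifs
    · exact cs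
    · rw [zero_pow two_ne_zero]; positivity
  simp only [← pow_two]
  have hv := sq_nonneg (v : ℝ)
  nlinarith [mul_le_mul_of_nonneg_left this hv]

theorem relu_nonneg (t : ℝ) : 0 ≤ relu t := le_max_right _ _

theorem relu_sq_le (t : ℝ) : relu t ^ 2 ≤ t ^ 2 := by
  unfold relu
  rcases le_total t 0 with h | h
  · rw [max_eq_right h]; nlinarith
  · rw [max_eq_left h]

theorem lintegral_relu_norms_le (x y : κ → ℝ) :
    ∫⁻ W : ι → κ → ℝ, ENNReal.ofReal ((∑ i, relu (∑ k, W i k * x k) ^ 2) *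
      (∑ i, relu (∑ k, W i k * y k) ^ 2)) ∂(gaussianMatrix ι κ v) ≤
      ENNReal.ofReal (3 * (Fintype.card ι : ℝ) ^ 2 * (v : ℝ) ^ 2 * ((∑ k, x k ^ 2) *
        (∑ k, y k ^ 2))) := by
  have h1 : ∫⁻ W : ι → κ → ℝ, ENNReal.ofReal (∑ i, ∑ j, (∑ k, W i k * x k) ^ 2 *
      (∑ k, W j k * y k) ^ 2) ∂(gaussianMatrix ι κ v) ≤
      ENNReal.ofReal (3 * (Fintype.card ι : ℝ) ^ 2 * (v : ℝ) ^ 2 * ((∑ k, x k ^ 2) *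
        (∑ k, y k ^ 2))) := by
    refine lintegral_ofReal_le_of_integral_le ?_ (fun W => by positivity) ?_
    · exact integrable_finsetSum _ fun i _ => integrable_finsetSum _ fun j _ =>
        integrable_row_sq_mul_row_sq i j x y
    · rw [integral_finsetSum _ fun i _ => integrable_finsetSum _ fun j _ =>
        integrable_row_sq_mul_row_sq i j x y]
      calc _ ≤ ∑ i : ι, ∑ j : ι, 3 * (v : ℝ) ^ 2 * (∑ k, x k ^ 2) * (∑ k, y k ^ 2) := by
            refine Finset.sum_le_sum fun i _ => ?_
            rw [integral_finsetSum _ fun j _ => integrable_row_sq_mul_row_sq i j x y]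
            exact Finset.sum_le_sum fun j _ => integral_row_sq_mul_row_sq_le i j x y
        _ = _ := by simp; ring
  refine le_trans (lintegral_mono fun W => ENNReal.ofReal_le_ofReal ?_) h1
  rw [Finset.sum_mul_sum]
  refine Finset.sum_le_sum fun i _ => Finset.sum_le_sum fun j _ => ?_
  exact mul_le_mul (relu_sq_le _) (relu_sq_le _) (by positivity) (by positivity)

/-- The bilinear form `W i ᵀ A W j` of two rows of `W`. -/
def rowForm (A : κ → κ → ℝ) (W : ι → κ → ℝ) (i j : ι) : ℝ := ∑ k, ∑ l, W i k * A k l * W j l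

/-- The deviation of `W i ᵀ A W j` from its mean when the entries of `W` have variance `s`. -/
def rowDev (s : ℝ) (A : κ → κ → ℝ) (W : ι → κ → ℝ) (i j : ι) : ℝ :=
  rowForm A W i j - if i = j then s * ∑ k, A k k else 0

variable [DecidableEq κ]

theorem entry_eq_matLin (W : ι → κ → ℝ) (i : ι) (k : κ) :
    W i k = matLin (rowVec i (Pi.single k 1)) W := by
  rw [matLin_rowVec, Finset.sum_eq_single k]
  · simp
  · intro l _ hl
    simp [Pi.single_eq_of_ne hl]
  · simp

theorem matDot_entry (i j : ι) (k l : κ) :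
    matDot (rowVec i (Pi.single k (1 : ℝ))) (rowVec j (Pi.single l 1)) =
      if i = j ∧ k = l then 1 else 0 := by
  rw [matDot_rowVec]
  by_cases h : i = j
  · by_cases h' : k = l
    · subst h'; simp [h, Pi.single_apply]
    · simp [h, h', Ne.symm h', Pi.single_apply]
  · simp [h]

theorem integrable_rowForm (A : κ → κ → ℝ) (i j : ι) :
    Integrable (fun W => rowForm A W i j) (gaussianMatrix ι κ v) := by
  unfold rowForm
  refine integrable_finsetSum _ fun k _ => integrable_finsetSum _ fun l _ => ?_
  refine ((integrable_matLin_mul (rowVec i (Pi.single k 1))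
    (rowVec j (Pi.single l 1))).const_mul (A k l)).congr (Filter.Eventually.of_forall fun W => ?_)
  simp only [← entry_eq_matLin]
  ring

theorem integral_rowForm (A : κ → κ → ℝ) (i j : ι) :
    ∫ W, rowForm A W i j ∂(gaussianMatrix ι κ v) = if i = j then v * ∑ k, A k k else 0 := by
  unfold rowForm
  have e : ∀ k l, ∀ W : ι → κ → ℝ, W i k * A k l * W j l =
      A k l * (matLin (rowVec i (Pi.single k 1)) W * matLin (rowVec j (Pi.single l 1)) W) := by
    intro k l W
    simp only [← entry_eq_matLin]
    ring
  simp only [e]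
  have I : ∀ k l, Integrable (fun W : ι → κ → ℝ => A k l * (matLin (rowVec i (Pi.single k 1)) W *
      matLin (rowVec j (Pi.single l 1)) W)) (gaussianMatrix ι κ v) :=
    fun k l => (integrable_matLin_mul _ _).const_mul _
  rw [integral_finsetSum _ fun k _ => integrable_finsetSum _ fun l _ => I k l]
  simp only [integral_finsetSum _ fun l _ => I _ l, integral_const_mul, integral_matLin_mul,
    matDot_entry]
  by_cases h : i = j
  · simp [h, Finset.mul_sum, mul_comm]
  · simp [h]

theorem rowForm_sq (A : κ → κ → ℝ) (i j : ι) (W : ι → κ → ℝ) : rowForm A W i j ^ 2 =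
    ∑ k, ∑ l, ∑ k', ∑ l', A k l * A k' l' * (matLin (rowVec i (Pi.single k 1)) W *
      matLin (rowVec j (Pi.single l 1)) W * matLin (rowVec i (Pi.single k' 1)) W *
      matLin (rowVec j (Pi.single l' 1)) W) := by
  unfold rowForm
  rw [pow_two, Finset.sum_mul]
  refine Finset.sum_congr rfl fun k _ => ?_
  rw [Finset.sum_mul]
  refine Finset.sum_congr rfl fun l _ => ?_
  rw [Finset.mul_sum]
  refine Finset.sum_congr rfl fun k' _ => ?_
  rw [Finset.mul_sum]
  refine Finset.sum_congr rfl fun l' _ => ?_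
  simp only [← entry_eq_matLin]
  ring

theorem integrable_rowForm_sq (A : κ → κ → ℝ) (i j : ι) :
    Integrable (fun W => rowForm A W i j ^ 2) (gaussianMatrix ι κ v) := by
  simp only [rowForm_sq]
  exact integrable_finsetSum _ fun k _ => integrable_finsetSum _ fun l _ =>
    integrable_finsetSum _ fun k' _ => integrable_finsetSum _ fun l' _ =>
    (integrable_matLin_mul_four _ _ _ _).const_mul _

theorem integral_rowForm_sq_le (A : κ → κ → ℝ) (i j : ι) :
    ∫ W, rowForm A W i j ^ 2 ∂(gaussianMatrix ι κ v) ≤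
      (if i = j then v * ∑ k, A k k else 0) ^ 2 + 2 * (v : ℝ) ^ 2 * ∑ k, ∑ l, A k l ^ 2 := by
  simp only [rowForm_sq]
  have I : ∀ k l k' l', Integrable (fun W : ι → κ → ℝ => A k l * A k' l' *
      (matLin (rowVec i (Pi.single k 1)) W *
      matLin (rowVec j (Pi.single l 1)) W * matLin (rowVec i (Pi.single k' 1)) W *
      matLin (rowVec j (Pi.single l' 1)) W)) (gaussianMatrix ι κ v) :=
    fun k l k' l' => (integrable_matLin_mul_four _ _ _ _).const_mul _
  have e : ∫ W, (∑ k, ∑ l, ∑ k', ∑ l', A k l * A k' l' * (matLin (rowVec i (Pi.single k 1)) W *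
      matLin (rowVec j (Pi.single l 1)) W * matLin (rowVec i (Pi.single k' 1)) W *
      matLin (rowVec j (Pi.single l' 1)) W)) ∂(gaussianMatrix ι κ v) =
      ∑ k, ∑ l, ∑ k', ∑ l', A k l * A k' l' * ((v : ℝ) ^ 2 *
        ((if i = j ∧ k = l then 1 else 0) * (if i = j ∧ k' = l' then 1 else 0)
        + (if k = k' then 1 else 0) * (if l = l' then 1 else 0)
        + (if i = j ∧ k = l' then 1 else 0) * (if j = i ∧ l = k' then 1 else 0))) := by
    rw [integral_finsetSum _ fun k _ => integrable_finsetSum _ fun l _ =>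
      integrable_finsetSum _ fun k' _ => integrable_finsetSum _ fun l' _ => I k l k' l']
    refine Finset.sum_congr rfl fun k _ => ?_
    rw [integral_finsetSum _ fun l _ =>
      integrable_finsetSum _ fun k' _ => integrable_finsetSum _ fun l' _ => I k l k' l']
    refine Finset.sum_congr rfl fun l _ => ?_
    rw [integral_finsetSum _ fun k' _ => integrable_finsetSum _ fun l' _ => I k l k' l']
    refine Finset.sum_congr rfl fun k' _ => ?_
    rw [integral_finsetSum _ fun l' _ => I k l k' l']
    refine Finset.sum_congr rfl fun l' _ => ?_
    rw [integral_const_mul, integral_matLin_mul_four]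
    simp only [matDot_entry, true_and]
  rw [e]
  have hsq : ∀ (f : κ → ℝ), (∑ k, f k) ^ 2 = ∑ k, ∑ l, f k * f l := fun f => by
    rw [pow_two, Finset.sum_mul_sum]
  have e2 : ∑ k, ∑ l, ∑ k', ∑ l', A k l * A k' l' * ((v : ℝ) ^ 2 *
      ((if k = k' then 1 else 0) * (if l = l' then 1 else 0))) =
      (v : ℝ) ^ 2 * ∑ k, ∑ l, A k l ^ 2 := by
    simp only [mul_ite, mul_one, mul_zero, Finset.sum_ite_eq, Finset.mem_univ, if_true,
      Finset.mul_sum]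
    refine Finset.sum_congr rfl fun k _ => Finset.sum_congr rfl fun l _ => ?_
    ring
  simp only [mul_add, Finset.sum_add_distrib]
  rw [e2]
  by_cases h : i = j
  · subst h
    simp only [true_and, if_true]
    have e1 : ∑ k, ∑ l, ∑ k', ∑ l', A k l * A k' l' * ((v : ℝ) ^ 2 *
        ((if k = l then 1 else 0) * (if k' = l' then 1 else 0))) = (v * ∑ k, A k k) ^ 2 := by
      rw [mul_pow, hsq, Finset.mul_sum]
      simp
      refine Finset.sum_congr rfl fun k _ => ?_
      rw [Finset.mul_sum]
      refine Finset.sum_congr rfl fun l _ => ?_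
      ring
    have e3 : ∑ k, ∑ l, ∑ k', ∑ l', A k l * A k' l' * ((v : ℝ) ^ 2 *
        ((if k = l' then 1 else 0) * (if l = k' then 1 else 0))) ≤
        (v : ℝ) ^ 2 * ∑ k, ∑ l, A k l ^ 2 := by
      have : ∑ k, ∑ l, ∑ k', ∑ l', A k l * A k' l' * ((v : ℝ) ^ 2 *
        ((if k = l' then 1 else 0) * (if l = k' then 1 else 0))) =
        ∑ k, ∑ l, (v : ℝ) ^ 2 * (A k l * A l k) := by
        simp
        refine Finset.sum_congr rfl fun k _ => Finset.sum_congr rfl fun l _ => ?_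
        ring
      rw [this]
      have h2 : ∑ k, ∑ l, (v : ℝ) ^ 2 * A l k ^ 2 = ∑ k, ∑ l, (v : ℝ) ^ 2 * A k l ^ 2 :=
        Finset.sum_comm
      have h3 : ∑ k, ∑ l, (v : ℝ) ^ 2 * (A k l * A l k) ≤
          (1 / 2) * (∑ k, ∑ l, (v : ℝ) ^ 2 * A k l ^ 2 + ∑ k, ∑ l, (v : ℝ) ^ 2 * A l k ^ 2) := by
        simp only [← Finset.sum_add_distrib, Finset.mul_sum]
        refine Finset.sum_le_sum fun k _ => Finset.sum_le_sum fun l _ => ?_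
        nlinarith [mul_nonneg (sq_nonneg (v : ℝ)) (sq_nonneg (A k l - A l k))]
      rw [h2] at h3
      simp only [Finset.mul_sum]
      linarith
    rw [e1]
    linarith
  · have hji : ¬ j = i := fun h' => h h'.symm
    simp [h]
    have : 0 ≤ (v : ℝ) ^ 2 * ∑ k, ∑ l, A k l ^ 2 := by positivity
    linarith

theorem lintegral_rowDev_sq_le (A : κ → κ → ℝ) (i j : ι) :
    ∫⁻ W, ENNReal.ofReal (rowDev v A W i j ^ 2) ∂(gaussianMatrix ι κ v) ≤
      ENNReal.ofReal (2 * (v : ℝ) ^ 2 * ∑ k, ∑ l, A k l ^ 2) := by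
  set c : ℝ := if i = j then v * ∑ k, A k k else 0 with hc
  have e : ∀ W : ι → κ → ℝ, rowDev v A W i j ^ 2 =
      rowForm A W i j ^ 2 - 2 * c * rowForm A W i j + c ^ 2 := by
    intro W
    unfold rowDev
    rw [← hc]
    ring
  have I1 := integrable_rowForm_sq (v := v) A i j
  have I2 := (integrable_rowForm (v := v) A i j).const_mul (2 * c)
  refine lintegral_ofReal_le_of_integral_le ?_ (fun W => by positivity) ?_
  · simp only [e]
    exact (I1.sub I2).add (integrable_const _)
  · simp only [e]
    have I12 : Integrable (fun W => rowForm A W i j ^ 2 - 2 * c * rowForm A W i j)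
      (gaussianMatrix ι κ v) := I1.sub I2
    rw [integral_add I12 (integrable_const _), integral_sub I1 I2, integral_const_mul,
      integral_rowForm, ← hc]
    have := integral_rowForm_sq_le (v := v) A i j
    rw [← hc] at this
    simp
    linarith

end Rows

end GaussianEstimates

section LowerTail

variable {ι κ : Type*} [Fintype ι] [Fintype κ] {v : NNReal}

theorem measure_sum_lt_le {Ω : Type*} [MeasurableSpace Ω] {ν : Measure Ω}
    [IsProbabilityMeasure ν] {g : Ω → ℝ} (hg : MemLp g 2 ν) {m M : ℝ} (hm : 0 < m)
    (hgm : m ≤ ∫ w, g w ∂ν) (hM : ∫ w, g w ^ 2 ∂ν ≤ M) (hι : 0 < Fintype.card ι) :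
    (Measure.pi fun _ : ι => ν) {W | ∑ i, g (W i) < Fintype.card ι * m / 2} ≤
      ENNReal.ofReal (4 * M / (Fintype.card ι * m ^ 2)) := by
  have ha : (0 : ℝ) < Fintype.card ι := by exact_mod_cast hι
  set X : (ι → Ω) → ℝ := ∑ i, fun W : ι → Ω => g (W i) with hX
  have hgi : ∀ i : ι, MemLp (fun W : ι → Ω => g (W i)) 2 (Measure.pi fun _ : ι => ν) := fun i =>
    hg.comp_measurePreserving (measurePreserving_eval (fun _ : ι => ν) i)
  have hXL : MemLp X 2 (Measure.pi fun _ : ι => ν) := memLp_finsetSum' _ fun i _ => hgi i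
  have hXm : ∫ W, X W ∂(Measure.pi fun _ : ι => ν) = Fintype.card ι * ∫ w, g w ∂ν := by
    simp only [hX, Finset.sum_apply]
    rw [integral_finsetSum _ fun i _ => (hgi i).integrable one_le_two]
    simp [integral_comp_eval (μ := fun _ : ι => ν) hg.aestronglyMeasurable]
  have hv : Var[X; Measure.pi fun _ : ι => ν] ≤ Fintype.card ι * M := by
    rw [hX, variance_sum_pi (X := fun _ => g) fun _ => hg]
    have : Var[g; ν] ≤ M := (variance_le_expectation_sq hg.aestronglyMeasurable).trans hM
    simpa using mul_le_mul_of_nonneg_left this ha.le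
  have hc : 0 < Fintype.card ι * m / 2 := by positivity
  refine le_trans (measure_mono ?_) ((meas_ge_le_variance_div_sq hXL hc).trans
    (ENNReal.ofReal_le_ofReal ?_))
  · intro W hW
    simp only [Set.mem_ofPred_eq] at hW ⊢
    rw [hXm, abs_sub_comm]
    have h1 : X W = ∑ i, g (W i) := by simp [hX]
    have h2 := mul_le_mul_of_nonneg_left hgm ha.le
    refine le_trans ?_ (le_abs_self _)
    rw [h1]
    linarith
  · rw [div_le_div_iff₀ (by positivity) (by positivity)]
    calc _ ≤ Fintype.card ι * M * (Fintype.card ι * m ^ 2) := by gcongr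
      _ = _ := by ring

/-- The mean of the product of two rectified Gaussian linear forms. -/
def reluCov (v : NNReal) (x y : κ → ℝ) : ℝ :=
  ∫ w, relu (∑ k, w k * x k) * relu (∑ k, w k * y k) ∂(Measure.pi fun _ : κ => gaussianReal 0 v)

theorem measurable_relu : Measurable relu := by
  unfold relu; fun_prop

theorem integrable_row_sq_mul (x y : κ → ℝ) :
    Integrable (fun w : κ → ℝ => (∑ k, w k * x k) ^ 2 * (∑ k, w k * y k) ^ 2)
      (Measure.pi fun _ : κ => gaussianReal 0 v) := by
  have h := integrable_row_sq_mul_row_sq (ι := Unit) (v := v) () () x y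
  refine ((measurePreserving_eval (fun _ : Unit => Measure.pi fun _ : κ => gaussianReal 0 v)
    ()).integrable_comp (Measurable.aestronglyMeasurable (by fun_prop))).1 h

theorem integral_row_sq_mul_le (x y : κ → ℝ) :
    ∫ w : κ → ℝ, (∑ k, w k * x k) ^ 2 * (∑ k, w k * y k) ^ 2
      ∂(Measure.pi fun _ : κ => gaussianReal 0 v) ≤
      3 * (v : ℝ) ^ 2 * (∑ k, x k ^ 2) * (∑ k, y k ^ 2) := by
  have h := integral_row_sq_mul_row_sq_le (ι := Unit) (v := v) () () x y
  rwa [integral_comp_eval (μ := fun _ : Unit => Measure.pi fun _ : κ => gaussianReal 0 v)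
    (i := ()) (f := fun w : κ → ℝ => (∑ k, w k * x k) ^ 2 * (∑ k, w k * y k) ^ 2)
    (Measurable.aestronglyMeasurable (by fun_prop))] at h

theorem measurable_relu_mul_relu (x y : κ → ℝ) :
    Measurable fun w : κ → ℝ => relu (∑ k, w k * x k) * relu (∑ k, w k * y k) :=
  (measurable_relu.comp (by fun_prop)).mul (measurable_relu.comp (by fun_prop))

theorem relu_mul_relu_sq_le (s t : ℝ) : (relu s * relu t) ^ 2 ≤ s ^ 2 * t ^ 2 := by
  rw [mul_pow]
  exact mul_le_mul (relu_sq_le _) (relu_sq_le _) (by positivity) (by positivity)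

theorem memLp_relu_mul_relu (x y : κ → ℝ) :
    MemLp (fun w : κ → ℝ => relu (∑ k, w k * x k) * relu (∑ k, w k * y k)) 2
      (Measure.pi fun _ : κ => gaussianReal 0 v) := by
  have hm := (measurable_relu_mul_relu x y).aestronglyMeasurable
    (μ := Measure.pi fun _ : κ => gaussianReal 0 v)
  refine (memLp_two_iff_integrable_sq hm).2 ((integrable_row_sq_mul x y).mono' (hm.pow 2)
    (Filter.Eventually.of_forall fun w => ?_))
  rw [Real.norm_of_nonneg (sq_nonneg _)]
  exact relu_mul_relu_sq_le _ _

theorem measure_sum_relu_lt_le (x y : κ → ℝ) {m : ℝ} (hm : 0 < m) (hxy : m ≤ reluCov v x y)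
    (hι : 0 < Fintype.card ι) :
    gaussianMatrix ι κ v {W | ∑ i, relu (∑ k, W i k * x k) * relu (∑ k, W i k * y k) <
      Fintype.card ι * m / 2} ≤
      ENNReal.ofReal (12 * ((v : ℝ) ^ 2 * ((∑ k, x k ^ 2) * (∑ k, y k ^ 2))) /
        (Fintype.card ι * m ^ 2)) := by
  have h2 : ∫ w : κ → ℝ, (relu (∑ k, w k * x k) * relu (∑ k, w k * y k)) ^ 2
      ∂(Measure.pi fun _ : κ => gaussianReal 0 v) ≤
      3 * (v : ℝ) ^ 2 * (∑ k, x k ^ 2) * (∑ k, y k ^ 2) := by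
    refine le_trans (integral_mono (memLp_relu_mul_relu x y).integrable_sq
      (integrable_row_sq_mul x y) fun w => ?_) (integral_row_sq_mul_le x y)
    exact relu_mul_relu_sq_le _ _
  refine (measure_sum_lt_le (ι := ι) (memLp_relu_mul_relu (v := v) x y) hm hxy h2 hι).trans_eq ?_
  congr 2
  ring

theorem gaussianReal_abs_le_le {s : NNReal} (hs : s ≠ 0) :
    gaussianReal 0 s {t | |t| ≤ Real.sqrt s / 8} ≤ ENNReal.ofReal (1 / 4) := by
  have hs' : (0 : ℝ) < s := by positivity
  have hset : {t : ℝ | |t| ≤ Real.sqrt s / 8} = Set.Icc (-(Real.sqrt s / 8)) (Real.sqrt s / 8) := by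
    ext t; simp [abs_le]
  rw [hset, gaussianReal_apply _ hs]
  calc ∫⁻ t in Set.Icc (-(Real.sqrt s / 8)) (Real.sqrt s / 8), gaussianPDF 0 s t
      ≤ ∫⁻ t in Set.Icc (-(Real.sqrt s / 8)) (Real.sqrt s / 8),
          ENNReal.ofReal ((Real.sqrt s)⁻¹) := by
        refine lintegral_mono fun t => ENNReal.ofReal_le_ofReal ?_
        rw [gaussianPDFReal]
        have h1 : Real.exp (-(t - 0) ^ 2 / (2 * s)) ≤ 1 := by
          rw [Real.exp_le_one_iff]
          exact div_nonpos_of_nonpos_of_nonneg (by nlinarith [sq_nonneg (t - 0)]) (by positivity)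
        have h2 : Real.sqrt s ≤ Real.sqrt (2 * Real.pi * s) := by
          apply Real.sqrt_le_sqrt
          nlinarith [Real.pi_gt_three]
        have h3 : (Real.sqrt (2 * Real.pi * s))⁻¹ ≤ (Real.sqrt s)⁻¹ :=
          inv_anti₀ (Real.sqrt_pos.2 hs') h2
        calc _ ≤ (Real.sqrt (2 * Real.pi * s))⁻¹ * 1 := by gcongr
          _ ≤ _ := by rwa [mul_one]
    _ = ENNReal.ofReal (1 / 4) := by
        rw [setLIntegral_const, Real.volume_Icc, ← ENNReal.ofReal_mul (by positivity)]
        congr 1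
        have := (Real.sqrt_pos.2 hs').ne'
        field_simp
        ring

theorem measure_rowLin_abs_le_le {x : κ → ℝ} (hv : v ≠ 0) (hx : 0 < ∑ k, x k ^ 2) :
    (Measure.pi fun _ : κ => gaussianReal 0 v)
      {w | |∑ k, w k * x k| ≤ Real.sqrt (v * ∑ k, x k ^ 2) / 8} ≤ ENNReal.ofReal (1 / 4) := by
  have h0 : v * (∑ k, x k ^ 2).toNNReal ≠ 0 := by
    simp [hv, hx]
  have h := gaussianReal_abs_le_le h0
  rw [← map_rowLin, Measure.map_apply (measurable_rowLin x)
    (measurableSet_le (by fun_prop) measurable_const)] at h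
  have e : ((v * (∑ k, x k ^ 2).toNNReal : NNReal) : ℝ) = v * ∑ k, x k ^ 2 := by
    rw [NNReal.coe_mul, Real.coe_toNNReal _ hx.le]
  rw [e] at h
  simpa only [Set.preimage_ofPred_eq, mul_comm (x _)] using h

theorem integral_row_mul_row (x y : κ → ℝ) :
    ∫ w : κ → ℝ, (∑ k, w k * x k) * (∑ k, w k * y k)
      ∂(Measure.pi fun _ : κ => gaussianReal 0 v) = v * ∑ k, x k * y k := by
  have h := integral_matLin_mul (v := v) (rowVec () x) (rowVec () y)
  simp only [matLin_rowVec, matDot_rowVec, if_true] at h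
  rw [← h, integral_comp_eval (μ := fun _ : Unit => Measure.pi fun _ : κ => gaussianReal 0 v)
    (i := ()) (f := fun w : κ → ℝ => (∑ k, x k * w k) * (∑ k, y k * w k))
    (Measurable.aestronglyMeasurable (by fun_prop))]
  simp only [mul_comm (x _), mul_comm (y _)]

theorem integrable_row_mul_row (x y : κ → ℝ) :
    Integrable (fun w : κ → ℝ => (∑ k, w k * x k) * (∑ k, w k * y k))
      (Measure.pi fun _ : κ => gaussianReal 0 v) := by
  have h := (memLp_rowLin (v := v) x (p := 2) (by simp)).integrable_mul
    (memLp_rowLin (v := v) y (p := 2) (by simp))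
  change Integrable (fun w : κ → ℝ => (∑ k, x k * w k) * (∑ k, y k * w k)) _ at h
  simpa only [mul_comm (x _), mul_comm (y _)] using h

theorem relu_mul_relu_add (s t : ℝ) :
    relu s * relu t + relu (-s) * relu (-t) = (s * t + |s * t|) / 2 := by
  unfold relu
  rw [abs_mul]
  rcases le_total s 0 with hs | hs <;> rcases le_total t 0 with ht | ht <;>
    simp [abs_of_nonneg, abs_of_nonpos, hs, ht]

theorem reluCov_eq (x y : κ → ℝ) : reluCov v x y =
    (v * ∑ k, x k * y k + ∫ w, |(∑ k, w k * x k) * (∑ k, w k * y k)|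
      ∂(Measure.pi fun _ : κ => gaussianReal 0 v)) / 4 := by
  set ν := Measure.pi fun _ : κ => gaussianReal 0 v with hR
  have hneg : Measure.map (fun w : κ → ℝ => fun k => -w k) ν = ν := by
    rw [hR, Measure.pi_map_pi (f := fun _ t => -t) (by fun_prop)]
    simp [gaussianReal_map_neg]
  have I := (memLp_relu_mul_relu (v := v) x y).integrable one_le_two
  have In := (memLp_relu_mul_relu (v := v) (-x) (-y)).integrable one_le_two
  have hsymm : reluCov v x y = reluCov v (-x) (-y) := by
    unfold reluCov
    rw [← hR, ← hneg, integral_map (Measurable.aemeasurable (by fun_prop))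
      (measurable_relu_mul_relu _ _).aestronglyMeasurable, hneg]
    simp
  have h : reluCov v x y + reluCov v (-x) (-y) = (v * ∑ k, x k * y k +
      ∫ w, |(∑ k, w k * x k) * (∑ k, w k * y k)| ∂ν) / 2 := by
    rw [← integral_row_mul_row, ← hR]
    unfold reluCov
    rw [← hR, ← integral_add I In, ← integral_add (integrable_row_mul_row x y)
      (integrable_row_mul_row x y).abs, ← integral_div]
    congr 1
    ext w
    simp only [Pi.neg_apply, mul_neg, Finset.sum_neg_distrib]
    exact relu_mul_relu_add _ _
  linarith

theorem reluCov_ge {x y : κ → ℝ} (hxy : 0 ≤ ∑ k, x k * y k) :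
    v * Real.sqrt ((∑ k, x k ^ 2) * (∑ k, y k ^ 2)) / 512 ≤ reluCov v x y := by
  set ν := Measure.pi fun _ : κ => gaussianReal 0 v with hR
  have h0 : 0 ≤ ∫ w, |(∑ k, w k * x k) * (∑ k, w k * y k)| ∂ν :=
    integral_nonneg fun w => abs_nonneg _
  suffices h : v * Real.sqrt ((∑ k, x k ^ 2) * (∑ k, y k ^ 2)) / 128 ≤
      ∫ w, |(∑ k, w k * x k) * (∑ k, w k * y k)| ∂ν by
    rw [reluCov_eq]
    have : 0 ≤ v * ∑ k, x k * y k := by positivity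
    linarith
  rcases eq_or_ne v 0 with rfl | hv
  · simpa using h0
  rcases (show 0 ≤ ∑ k, x k ^ 2 by positivity).eq_or_lt with hx | hx
  · rw [← hx]; simpa using h0
  rcases (show 0 ≤ ∑ k, y k ^ 2 by positivity).eq_or_lt with hy | hy
  · rw [← hy]; simpa using h0
  set A := {w : κ → ℝ | |∑ k, w k * x k| ≤ Real.sqrt (v * ∑ k, x k ^ 2) / 8} with hA
  set B := {w : κ → ℝ | |∑ k, w k * y k| ≤ Real.sqrt (v * ∑ k, y k ^ 2) / 8} with hB
  have mA : MeasurableSet A := measurableSet_le (by fun_prop) measurable_const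
  have mB : MeasurableSet B := measurableSet_le (by fun_prop) measurable_const
  have hR2 : ν.real (A ∪ B) ≤ 1 / 2 := by
    refine (measureReal_union_le _ _).trans ?_
    have h1 : ν.real A ≤ 1 / 4 :=
      ENNReal.toReal_le_of_le_ofReal (by norm_num) (measure_rowLin_abs_le_le hv hx)
    have h2 : ν.real B ≤ 1 / 4 :=
      ENNReal.toReal_le_of_le_ofReal (by norm_num) (measure_rowLin_abs_le_le hv hy)
    linarith
  have hc : 1 / 2 ≤ ν.real (A ∪ B)ᶜ := by
    rw [probReal_compl_eq_one_sub (mA.union mB)]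
    linarith
  set c := v * Real.sqrt ((∑ k, x k ^ 2) * (∑ k, y k ^ 2)) / 64 with hcdef
  have hc0 : 0 ≤ c := by positivity
  have key : ∫ w, (A ∪ B)ᶜ.indicator (fun _ => c) w ∂ν ≤
      ∫ w, |(∑ k, w k * x k) * (∑ k, w k * y k)| ∂ν := by
    refine integral_mono ((integrable_const c).indicator (mA.union mB).compl)
      (integrable_row_mul_row x y).abs fun w => ?_
    by_cases hw : w ∈ (A ∪ B)ᶜ
    · rw [Set.indicator_of_mem hw]
      simp only [Set.mem_compl_iff, Set.mem_union, not_or, hA, hB, Set.mem_ofPred_eq, not_le] at hw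
      rw [abs_mul]
      have : c = (Real.sqrt (v * ∑ k, x k ^ 2) / 8) * (Real.sqrt (v * ∑ k, y k ^ 2) / 8) := by
        rw [hcdef, Real.sqrt_mul hx.le, Real.sqrt_mul v.coe_nonneg, Real.sqrt_mul v.coe_nonneg]
        have := Real.mul_self_sqrt v.coe_nonneg
        linear_combination (-1 / 64) * Real.sqrt (∑ k, x k ^ 2) * Real.sqrt (∑ k, y k ^ 2) * this
      rw [this]
      exact mul_le_mul hw.1.le hw.2.le (by positivity) (abs_nonneg _)
    · rw [Set.indicator_of_notMem hw]
      exact abs_nonneg _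
  rw [integral_indicator_const _ (mA.union mB).compl, smul_eq_mul] at key
  have : 1 / 2 * c ≤ ν.real (A ∪ B)ᶜ * c := by gcongr
  rw [hcdef] at this key
  linarith

/-- Lower tail of the inner product of two rectified images, for inputs with nonnegative inner
product. -/
theorem measure_sum_relu_lt_sqrt_le {x y : κ → ℝ} (hxy : 0 ≤ ∑ k, x k * y k) (hv : v ≠ 0)
    (hι : 0 < Fintype.card ι) :
    gaussianMatrix ι κ v {W | ∑ i, relu (∑ k, W i k * x k) * relu (∑ k, W i k * y k) <
      Fintype.card ι * (v * Real.sqrt ((∑ k, x k ^ 2) * (∑ k, y k ^ 2))) / 1024} ≤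
      ENNReal.ofReal (12 * 512 ^ 2 / Fintype.card ι) := by
  have ha : (0 : ℝ) < Fintype.card ι := by exact_mod_cast hι
  set P := (∑ k, x k ^ 2) * (∑ k, y k ^ 2) with hP
  have hP0 : 0 ≤ P := by positivity
  rcases hP0.eq_or_lt with h0 | h0
  · have : {W : ι → κ → ℝ | ∑ i, relu (∑ k, W i k * x k) * relu (∑ k, W i k * y k) <
      Fintype.card ι * (v * Real.sqrt P) / 1024} = ∅ := by
      ext W
      simp only [← h0, Real.sqrt_zero, mul_zero, zero_div, Set.mem_ofPred_eq,
        Set.mem_empty_iff_false, iff_false, not_lt]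
      exact Finset.sum_nonneg fun i _ => mul_nonneg (relu_nonneg _) (relu_nonneg _)
    rw [this]; simp
  · have hv' : (0 : ℝ) < v := by positivity
    have hm : 0 < v * Real.sqrt P / 512 := by positivity
    have h := measure_sum_relu_lt_le (ι := ι) x y hm (reluCov_ge hxy) hι
    have e1 : ∀ a : ℝ, a * (v * Real.sqrt P / 512) / 2 = a * (v * Real.sqrt P) / 1024 := by
      intro a; ring
    simp only [e1] at h
    refine h.trans_eq ?_
    congr 1
    rw [← hP, div_pow, mul_pow, Real.sq_sqrt hP0]
    field_simp

theorem reluCov_pos {x y : κ → ℝ} (hv : v ≠ 0) {w : κ → ℝ} (hx : 0 < ∑ k, w k * x k)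
    (hy : 0 < ∑ k, w k * y k) : 0 < reluCov v x y := by
  have : (gaussianReal 0 v).IsOpenPosMeasure :=
    (gaussianReal_absolutelyContinuous' 0 hv).isOpenPosMeasure
  unfold reluCov
  rw [integral_pos_iff_support_of_nonneg (fun w => mul_nonneg (relu_nonneg _) (relu_nonneg _))
    ((memLp_relu_mul_relu x y).integrable one_le_two)]
  have ho : IsOpen {w : κ → ℝ | 0 < ∑ k, w k * x k ∧ 0 < ∑ k, w k * y k} :=
    IsOpen.inter (isOpen_lt (g := fun w : κ → ℝ => ∑ k, w k * x k) continuous_const (by fun_prop))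
      (isOpen_lt (g := fun w : κ → ℝ => ∑ k, w k * y k) continuous_const (by fun_prop))
  refine lt_of_lt_of_le (ho.measure_pos _ ⟨w, hx, hy⟩) (measure_mono ?_)
  rintro u ⟨h1, h2⟩
  simp only [Function.mem_support, relu, max_eq_left h1.le, max_eq_left h2.le]
  positivity

theorem exists_pos_of_not_antipodal {x y : κ → ℝ} (hx : x ≠ 0) (hy : y ≠ 0)
    (h : ∀ a : ℝ, 0 < a → y ≠ -(a • x)) : ∃ w : κ → ℝ, 0 < ∑ k, w k * x k ∧ 0 < ∑ k, w k * y k := by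
  have hpos : ∀ z : κ → ℝ, z ≠ 0 → 0 < ∑ k, z k ^ 2 := by
    intro z hz
    obtain ⟨k, hk⟩ := Function.ne_iff.1 hz
    exact Finset.sum_pos' (fun _ _ => sq_nonneg _) ⟨k, Finset.mem_univ _, by
      have : z k ≠ 0 := hk
      positivity⟩
  set X := ∑ k, x k ^ 2 with hX
  set Y := ∑ k, y k ^ 2 with hY
  have X0 : 0 < X := hpos x hx
  have Y0 : 0 < Y := hpos y hy
  set p := Real.sqrt X
  set q := Real.sqrt Y
  have p0 : 0 < p := Real.sqrt_pos.2 X0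
  have q0 : 0 < q := Real.sqrt_pos.2 Y0
  have pp : p ^ 2 = X := Real.sq_sqrt X0.le
  have qq : q ^ 2 = Y := Real.sq_sqrt Y0.le
  set c := ∑ k, x k * y k with hc
  have hne : q • x + p • y ≠ 0 := by
    intro h0
    refine h (q / p) (by positivity) ?_
    ext k
    have := congrFun h0 k
    simp only [Pi.add_apply, Pi.smul_apply, smul_eq_mul, Pi.zero_apply, Pi.neg_apply] at this ⊢
    field_simp
    linarith
  have hs := hpos _ hne
  have e : ∑ k, (q • x + p • y) k ^ 2 = 2 * (p * q) * (p * q + c) := by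
    have : ∑ k, (q • x + p • y) k ^ 2 = q ^ 2 * X + 2 * p * q * c + p ^ 2 * Y := by
      rw [hX, hY, hc, Finset.mul_sum, Finset.mul_sum, Finset.mul_sum, ← Finset.sum_add_distrib,
        ← Finset.sum_add_distrib]
      refine Finset.sum_congr rfl fun k _ => ?_
      simp
      ring
    rw [this, ← pp, ← qq]
    ring
  rw [e] at hs
  have hpc : 0 < p * q + c := pos_of_mul_pos_right hs (by positivity)
  refine ⟨q • x + p • y, ?_, ?_⟩
  · have : ∑ k, (q • x + p • y) k * x k = p * (p * q + c) := by
      have : ∑ k, (q • x + p • y) k * x k = q * X + p * c := by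
        rw [hX, hc, Finset.mul_sum, Finset.mul_sum, ← Finset.sum_add_distrib]
        refine Finset.sum_congr rfl fun k _ => ?_
        simp
        ring
      rw [this, ← pp]; ring
    rw [this]; positivity
  · have : ∑ k, (q • x + p • y) k * y k = q * (p * q + c) := by
      have : ∑ k, (q • x + p • y) k * y k = q * c + p * Y := by
        rw [hY, hc, Finset.mul_sum, Finset.mul_sum, ← Finset.sum_add_distrib]
        refine Finset.sum_congr rfl fun k _ => ?_
        simp
        ring
      rw [this, ← qq]; ring
    rw [this]; positivity

theorem ae_rowLin_ne_zero {x : κ → ℝ} (hv : v ≠ 0) (hx : x ≠ 0) :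
    ∀ᵐ W ∂(gaussianMatrix ι κ v), ∀ i, ∑ k, W i k * x k ≠ 0 := by
  refine ae_all_iff.2 fun i => ?_
  have hx' : 0 < ∑ k, x k ^ 2 := by
    obtain ⟨k, hk⟩ := Function.ne_iff.1 hx
    exact Finset.sum_pos' (fun _ _ => sq_nonneg _) ⟨k, Finset.mem_univ _, by
      have : x k ≠ 0 := hk
      positivity⟩
  have h : ∀ᵐ t ∂(gaussianReal 0 (v * (∑ k, x k ^ 2).toNNReal)), t ≠ 0 := by
    have := nullSingletonClass_gaussianReal (μ := 0) (v := v * (∑ k, x k ^ 2).toNNReal)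
      (by simp [hv, hx'])
    exact Measure.ae_ne _ _
  rw [← map_rowLin] at h
  replace h := ae_of_ae_map (measurable_rowLin x).aemeasurable h
  have := (measurePreserving_eval (fun _ : ι => Measure.pi fun _ : κ => gaussianReal 0 v)
    i).quasiMeasurePreserving.ae h
  simpa only [mul_comm (x _)] using this

end LowerTail

theorem lintegral_pi_le_of_update {δ : Type*} [Fintype δ] [DecidableEq δ] {X : δ → Type*}
    [∀ i, MeasurableSpace (X i)] {μ : ∀ i, Measure (X i)} [∀ i, IsProbabilityMeasure (μ i)]
    (m : δ) {F G : (∀ i, X i) → ENNReal} (hF : Measurable F) (hG : Measurable G)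
    (hGm : ∀ θ W, G (Function.update θ m W) = G θ)
    (h : ∀ θ, ∫⁻ W, F (Function.update θ m W) ∂(μ m) ≤ G θ) :
    ∫⁻ θ, F θ ∂(Measure.pi μ) ≤ ∫⁻ θ, G θ ∂(Measure.pi μ) := by
  refine lintegral_le_of_lmarginal_le (μ := μ) {m} hF hG ?_
  rw [lmarginal_singleton, lmarginal_singleton]
  intro θ
  simpa [hGm] using h θ

section Layers

variable {w : ℕ → ℕ}

theorem layerOut_congr {θ θ' : (l : ℕ) → Fin (w (l + 1)) → Fin (w l) → ℝ} (x : Fin (w 0) → ℝ) :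
    ∀ l, (∀ k < l, θ k = θ' k) → layerOut w θ l x = layerOut w θ' l x
  | 0, _ => rfl
  | l + 1, h => by
    have ih := layerOut_congr x l fun k hk => h k (hk.trans (Nat.lt_succ_self l))
    funext i
    simp only [layerOut, ih, h l (Nat.lt_succ_self l)]

theorem layerOut_nonneg (θ : (l : ℕ) → Fin (w (l + 1)) → Fin (w l) → ℝ) (x : Fin (w 0) → ℝ)
    {l : ℕ} (hl : 1 ≤ l) (i : Fin (w l)) : 0 ≤ layerOut w θ l x i := by
  obtain ⟨l, rfl⟩ := Nat.exists_eq_add_of_le' hl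
  exact relu_nonneg _

/-- The derivative of the activation of unit `i` in layer `l + 1`. -/
def gate (w : ℕ → ℕ) (θ : (l : ℕ) → Fin (w (l + 1)) → Fin (w l) → ℝ) (l : ℕ)
    (x : Fin (w 0) → ℝ) (i : Fin (w (l + 1))) : ℝ :=
  if 0 < ∑ j, θ l i j * layerOut w θ l x j then 1 else 0

/-- The inner product of the hidden representations of two inputs. -/
def layerDot (w : ℕ → ℕ) (θ : (l : ℕ) → Fin (w (l + 1)) → Fin (w l) → ℝ)
    (x y : Fin (w 0) → ℝ) (l : ℕ) : ℝ :=
  ∑ k, layerOut w θ l x k * layerOut w θ l y k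

/-- The tangent kernel of layer `l` with respect to the weights of the previous layers, by forward
recursion. -/
def layerKer (w : ℕ → ℕ) (θ : (l : ℕ) → Fin (w (l + 1)) → Fin (w l) → ℝ)
    (x y : Fin (w 0) → ℝ) : (l : ℕ) → Fin (w l) → Fin (w l) → ℝ
  | 0 => 0
  | l + 1 => fun i j => gate w θ l x i * gate w θ l y j *
      ((if i = j then layerDot w θ x y l else 0) + rowForm (layerKer w θ x y l) (θ l) i j)

/-- The tangent kernel of the linear read-out of layer `l`. -/
def readoutKer (w : ℕ → ℕ) (θ : (l : ℕ) → Fin (w (l + 1)) → Fin (w l) → ℝ)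
    (x y : Fin (w 0) → ℝ) (l : ℕ) (i j : Fin (w (l + 1))) : ℝ :=
  (if i = j then layerDot w θ x y l else 0) + rowForm (layerKer w θ x y l) (θ l) i j

theorem layerKer_succ (θ : (l : ℕ) → Fin (w (l + 1)) → Fin (w l) → ℝ)
    (x y : Fin (w 0) → ℝ) (l : ℕ) (i j : Fin (w (l + 1))) :
    layerKer w θ x y (l + 1) i j =
      gate w θ l x i * gate w θ l y j * readoutKer w θ x y l i j := rfl

theorem layerDot_congr {θ θ' : (l : ℕ) → Fin (w (l + 1)) → Fin (w l) → ℝ} (x y : Fin (w 0) → ℝ)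
    (l : ℕ) (h : ∀ k < l, θ k = θ' k) : layerDot w θ x y l = layerDot w θ' x y l := by
  simp only [layerDot, layerOut_congr _ l h]

theorem layerKer_congr {θ θ' : (l : ℕ) → Fin (w (l + 1)) → Fin (w l) → ℝ} (x y : Fin (w 0) → ℝ) :
    ∀ l, (∀ k < l, θ k = θ' k) → layerKer w θ x y l = layerKer w θ' x y l
  | 0, _ => rfl
  | l + 1, h => by
    have hk : ∀ k < l, θ k = θ' k := fun k hk => h k (hk.trans (Nat.lt_succ_self l))
    funext i j
    simp only [layerKer, gate, layerKer_congr x y l hk, layerOut_congr _ l hk,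
      layerDot_congr x y l hk, h l (Nat.lt_succ_self l)]

theorem gate_mem (θ : (l : ℕ) → Fin (w (l + 1)) → Fin (w l) → ℝ) (l : ℕ)
    (x : Fin (w 0) → ℝ) (i : Fin (w (l + 1))) : gate w θ l x i = 0 ∨ gate w θ l x i = 1 := by
  unfold gate
  split_ifs <;> simp

section Measurability

variable {Ω : Type*} [MeasurableSpace Ω] {θ : Ω → (l : ℕ) → Fin (w (l + 1)) → Fin (w l) → ℝ}

theorem measurable_layerOut (hθ : ∀ l i j, Measurable fun ω => θ ω l i j) (x : Fin (w 0) → ℝ) :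
    ∀ l i, Measurable fun ω => layerOut w (θ ω) l x i
  | 0, i => by simpa only [layerOut] using measurable_const
  | l + 1, i => by
    have ih := measurable_layerOut hθ x l
    simp only [layerOut]
    exact measurable_relu.comp (Finset.measurable_sum _ fun j _ => (hθ l i j).mul (ih j))

theorem measurable_gate (hθ : ∀ l i j, Measurable fun ω => θ ω l i j) (x : Fin (w 0) → ℝ) (l i) :
    Measurable fun ω => gate w (θ ω) l x i := by
  unfold gate
  refine Measurable.ite (measurableSet_lt measurable_const ?_) measurable_const measurable_const
  exact Finset.measurable_sum _ fun j _ => (hθ l i j).mul (measurable_layerOut hθ x l j)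

theorem measurable_layerDot (hθ : ∀ l i j, Measurable fun ω => θ ω l i j)
    (x y : Fin (w 0) → ℝ) (l) : Measurable fun ω => layerDot w (θ ω) x y l :=
  Finset.measurable_sum _ fun j _ => (measurable_layerOut hθ x l j).mul (measurable_layerOut hθ y l j)

theorem measurable_layerKer (hθ : ∀ l i j, Measurable fun ω => θ ω l i j) (x y : Fin (w 0) → ℝ) :
    ∀ l i j, Measurable fun ω => layerKer w (θ ω) x y l i j
  | 0, i, j => by simpa only [layerKer] using measurable_const
  | l + 1, i, j => by
    have ih := measurable_layerKer hθ x y l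
    simp only [layerKer, rowForm]
    refine ((measurable_gate hθ x l i).mul (measurable_gate hθ y l j)).mul (Measurable.add ?_ ?_)
    · split_ifs
      · exact measurable_layerDot hθ x y l
      · exact measurable_const
    · exact Finset.measurable_sum _ fun k _ => Finset.measurable_sum _ fun k' _ =>
        ((hθ l i k).mul (ih k k')).mul (hθ l j k')

theorem measurable_rowDev_layerKer (hθ : ∀ l i j, Measurable fun ω => θ ω l i j)
    (x y : Fin (w 0) → ℝ) (s : ℝ) (l i j) :
    Measurable fun ω => rowDev s (layerKer w (θ ω) x y l) (θ ω l) i j := by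
  have ih := measurable_layerKer hθ x y l
  simp only [rowDev, rowForm]
  refine Measurable.sub ?_ ?_
  · exact Finset.measurable_sum _ fun k _ => Finset.measurable_sum _ fun k' _ =>
        ((hθ l i k).mul (ih k k')).mul (hθ l j k')
  · split_ifs
    · exact (Finset.measurable_sum _ fun k _ => ih k k).const_mul s
    · exact measurable_const

end Measurability

variable {L : ℕ}

theorem measurable_extParams (l : ℕ) (i : Fin (w (l + 1))) (j : Fin (w l)) :
    Measurable fun θ : Params L w => extParams θ l i j := by
  unfold extParams
  by_cases h : l < L
  · simp only [h, dif_pos]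
    fun_prop
  · simp only [h]
    exact measurable_const

theorem extParams_of_lt (θ : Params L w) {l : ℕ} (h : l < L) : extParams θ l = θ ⟨l, h⟩ := by
  simp [extParams, h]

theorem extParams_update_self (θ : Params L w) {m : ℕ} (h : m < L)
    (W : Fin (w (m + 1)) → Fin (w m) → ℝ) :
    extParams (Function.update θ ⟨m, h⟩ W) m = W := by
  simp [extParams, h]

theorem extParams_update_of_lt (θ : Params L w) {m : ℕ} (h : m < L)
    (W : Fin (w (m + 1)) → Fin (w m) → ℝ) {k : ℕ} (hk : k < m) :
    extParams (Function.update θ ⟨m, h⟩ W) k = extParams θ k := by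
  have hkL := hk.trans h
  have hne : (⟨k, hkL⟩ : Fin L) ≠ ⟨m, h⟩ := fun e => hk.ne (Fin.mk.inj_iff.1 e)
  rw [extParams_of_lt _ hkL, extParams_of_lt _ hkL, Function.update_of_ne hne]

theorem layerOut_update (θ : Params L w) {m : ℕ} (h : m < L)
    (W : Fin (w (m + 1)) → Fin (w m) → ℝ) (x : Fin (w 0) → ℝ) :
    layerOut w (extParams (Function.update θ ⟨m, h⟩ W)) m x = layerOut w (extParams θ) m x :=
  layerOut_congr x m fun _ hk => extParams_update_of_lt θ h W hk

theorem layerKer_update (θ : Params L w) {m : ℕ} (h : m < L)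
    (W : Fin (w (m + 1)) → Fin (w m) → ℝ) (x y : Fin (w 0) → ℝ) :
    layerKer w (extParams (Function.update θ ⟨m, h⟩ W)) x y m = layerKer w (extParams θ) x y m :=
  layerKer_congr x y m fun _ hk => extParams_update_of_lt θ h W hk

theorem layerOut_succ_update (θ : Params L w) {m : ℕ} (h : m < L)
    (W : Fin (w (m + 1)) → Fin (w m) → ℝ) (x : Fin (w 0) → ℝ) (i : Fin (w (m + 1))) :
    layerOut w (extParams (Function.update θ ⟨m, h⟩ W)) (m + 1) x i =
      relu (∑ j, W i j * layerOut w (extParams θ) m x j) := by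
  simp only [layerOut, extParams_update_self, layerOut_update]

instance (L : ℕ) (w : ℕ → ℕ) : IsProbabilityMeasure (initMeasure L w) := by
  unfold initMeasure; infer_instance

/-- Average over the weights of layer `m` while the other layers are held fixed. -/
theorem lintegral_initMeasure_le {m : ℕ} (h : m < L) {F G : Params L w → ENNReal}
    (hF : Measurable F) (hG : Measurable G)
    (hGm : ∀ θ W, G (Function.update θ ⟨m, h⟩ W) = G θ)
    (hFG : ∀ θ, ∫⁻ W, F (Function.update θ ⟨m, h⟩ W)
      ∂(gaussianMatrix (Fin (w (m + 1))) (Fin (w m)) ((w m : NNReal))⁻¹) ≤ G θ) :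
    ∫⁻ θ, F θ ∂(initMeasure L w) ≤ ∫⁻ θ, G θ ∂(initMeasure L w) :=
  lintegral_pi_le_of_update (⟨m, h⟩ : Fin L) hF hG hGm hFG

theorem initMeasure_le_of_forall {m : ℕ} (h : m < L) {A : Set (Params L w)}
    (hA : MeasurableSet A) {p : ENNReal}
    (hp : ∀ θ : Params L w, gaussianMatrix (Fin (w (m + 1))) (Fin (w m)) ((w m : NNReal))⁻¹
      {W | Function.update θ ⟨m, h⟩ W ∈ A} ≤ p) :
    initMeasure L w A ≤ p := by
  have := lintegral_initMeasure_le h (F := A.indicator 1) (G := fun _ => p)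
    (measurable_one.indicator hA) measurable_const (fun _ _ => rfl) (fun θ => ?_)
  · simpa [hA] using this
  · refine le_trans (le_of_eq ?_) (hp θ)
    have hm : Measurable fun W : Fin (w (m + 1)) → Fin (w m) → ℝ =>
      Function.update θ (⟨m, h⟩ : Fin L) W := measurable_update θ (a := ⟨m, h⟩)
    exact lintegral_indicator_one (hm hA)

end Layers

/-- `f` is a nonnegative measurable function with mean at most `C`. -/
structure MeanLE {Ω : Type*} [MeasurableSpace Ω] (μ : Measure Ω) (f : Ω → ℝ) (C : ℝ) : Prop where
  meas : Measurable f
  nonneg : ∀ ω, 0 ≤ f ω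
  bound_nonneg : 0 ≤ C
  le : ∫⁻ ω, ENNReal.ofReal (f ω) ∂μ ≤ ENNReal.ofReal C

namespace MeanLE

variable {Ω : Type*} [MeasurableSpace Ω] {μ : Measure Ω} {f g : Ω → ℝ} {C C' : ℝ}

theorem add (hf : MeanLE μ f C) (hg : MeanLE μ g C') : MeanLE μ (fun ω => f ω + g ω) (C + C') where
  meas := hf.meas.add hg.meas
  nonneg ω := add_nonneg (hf.nonneg ω) (hg.nonneg ω)
  bound_nonneg := add_nonneg hf.bound_nonneg hg.bound_nonneg
  le := by
    simp only [ENNReal.ofReal_add (hf.nonneg _) (hg.nonneg _)]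
    rw [lintegral_add_left hf.meas.ennreal_ofReal,
      ENNReal.ofReal_add hf.bound_nonneg hg.bound_nonneg]
    exact add_le_add hf.le hg.le

theorem const_mul (hf : MeanLE μ f C) {c : ℝ} (hc : 0 ≤ c) :
    MeanLE μ (fun ω => c * f ω) (c * C) where
  meas := hf.meas.const_mul c
  nonneg ω := mul_nonneg hc (hf.nonneg ω)
  bound_nonneg := mul_nonneg hc hf.bound_nonneg
  le := by
    simp only [ENNReal.ofReal_mul hc]
    rw [lintegral_const_mul _ hf.meas.ennreal_ofReal]
    gcongr
    exact hf.le

theorem mono (hf : MeanLE μ f C) (hg : Measurable g) (h0 : ∀ ω, 0 ≤ g ω) (h : ∀ ω, g ω ≤ f ω) :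
    MeanLE μ g C where
  meas := hg
  nonneg := h0
  bound_nonneg := hf.bound_nonneg
  le := (lintegral_mono fun ω => ENNReal.ofReal_le_ofReal (h ω)).trans hf.le

theorem weaken (hf : MeanLE μ f C) (h : C ≤ C') : MeanLE μ f C' where
  meas := hf.meas
  nonneg := hf.nonneg
  bound_nonneg := hf.bound_nonneg.trans h
  le := hf.le.trans (ENNReal.ofReal_le_ofReal h)

theorem const [IsProbabilityMeasure μ] {c : ℝ} (hc : 0 ≤ c) : MeanLE μ (fun _ => c) c where
  meas := measurable_const
  nonneg _ := hc
  bound_nonneg := hc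
  le := by simp

theorem sum {ι : Type*} [Fintype ι] {f : ι → Ω → ℝ} (hC : 0 ≤ C) (hf : ∀ i, MeanLE μ (f i) C) :
    MeanLE μ (fun ω => ∑ i, f i ω) (Fintype.card ι * C) where
  meas := Finset.measurable_sum _ fun i _ => (hf i).meas
  nonneg ω := Finset.sum_nonneg fun i _ => (hf i).nonneg ω
  bound_nonneg := by positivity
  le := by
    simp only [ENNReal.ofReal_sum_of_nonneg fun i _ => (hf i).nonneg _]
    rw [lintegral_finsetSum _ fun i _ => (hf i).meas.ennreal_ofReal]
    refine (Finset.sum_le_sum fun i _ => (hf i).le).trans_eq ?_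
    simp [ENNReal.ofReal_mul]

theorem measure_ge_le (hf : MeanLE μ f C) {t : ℝ} (ht : 0 < t) :
    μ {ω | t ≤ f ω} ≤ ENNReal.ofReal (C / t) := by
  have h := meas_ge_le_lintegral_div (μ := μ) (hf.meas.ennreal_ofReal.aemeasurable)
    (ε := ENNReal.ofReal t) (by simpa using ht) ENNReal.ofReal_ne_top
  have e : {ω | t ≤ f ω} = {ω | ENNReal.ofReal t ≤ ENNReal.ofReal (f ω)} := by
    ext ω
    exact (ENNReal.ofReal_le_ofReal_iff (hf.nonneg ω)).symm
  rw [e, ENNReal.ofReal_div_of_pos ht]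
  exact h.trans (ENNReal.div_le_div_right hf.le _)

end MeanLE

section Moments

variable {w : ℕ → ℕ} {L : ℕ}

theorem MeanLE.of_update {m : ℕ} (h : m < L) {F G : Params L w → ℝ} {C : ℝ}
    (hF : Measurable F) (hF0 : ∀ θ, 0 ≤ F θ) (hG : MeanLE (initMeasure L w) G C)
    (hGm : ∀ θ W, G (Function.update θ ⟨m, h⟩ W) = G θ)
    (hFG : ∀ θ, ∫⁻ W, ENNReal.ofReal (F (Function.update θ ⟨m, h⟩ W))
      ∂(gaussianMatrix (Fin (w (m + 1))) (Fin (w m)) ((w m : NNReal))⁻¹) ≤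
        ENNReal.ofReal (G θ)) :
    MeanLE (initMeasure L w) F C where
  meas := hF
  nonneg := hF0
  bound_nonneg := hG.bound_nonneg
  le := (lintegral_initMeasure_le h hF.ennreal_ofReal hG.meas.ennreal_ofReal
    (fun θ W => by rw [hGm]) hFG).trans hG.le

theorem meanLE_layer_norms (hw : ∀ l, 0 < w l) (x y : Fin (w 0) → ℝ) : ∀ m, m ≤ L →
    MeanLE (initMeasure L w) (fun θ => (∑ k, layerOut w (extParams θ) m x k ^ 2) *
      (∑ k, layerOut w (extParams θ) m y k ^ 2))
      (3 ^ m * ((w m : ℝ) / w 0) ^ 2 * ((∑ k, x k ^ 2) * (∑ k, y k ^ 2)))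
  | 0, _ => by
    have h0 : (w 0 : ℝ) ≠ 0 := by exact_mod_cast (hw 0).ne'
    have : MeanLE (initMeasure L w) (fun _ => (∑ k, x k ^ 2) * (∑ k, y k ^ 2)) _ :=
      MeanLE.const (by positivity)
    simpa [layerOut, h0] using this
  | m + 1, hm => by
    have h0 : (w m : ℝ) ≠ 0 := by exact_mod_cast (hw m).ne'
    have ih := (meanLE_layer_norms hw x y m (Nat.le_of_succ_le hm)).const_mul
      (c := 3 * (w (m + 1) : ℝ) ^ 2 * ((w m : ℝ)⁻¹) ^ 2) (by positivity)
    refine (MeanLE.of_update hm ?_ (fun θ => by positivity) ih (fun θ W => ?_)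
      fun θ => ?_).weaken (le_of_eq ?_)
    · exact (Finset.measurable_sum _ fun k _ =>
        (measurable_layerOut measurable_extParams x _ k).pow_const 2).mul
        (Finset.measurable_sum _ fun k _ =>
        (measurable_layerOut measurable_extParams y _ k).pow_const 2)
    · simp only [layerOut_update]
    · simp only [layerOut_succ_update]
      simpa using lintegral_relu_norms_le (ι := Fin (w (m + 1))) (v := (w m : NNReal)⁻¹)
        (layerOut w (extParams θ) m x) (layerOut w (extParams θ) m y)
    · field_simp
      ring

theorem meanLE_layerDot_sq (hw : ∀ l, 0 < w l) (x y : Fin (w 0) → ℝ) {m : ℕ} (hm : m ≤ L) :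
    MeanLE (initMeasure L w) (fun θ => layerDot w (extParams θ) x y m ^ 2)
      (3 ^ m * ((w m : ℝ) / w 0) ^ 2 * ((∑ k, x k ^ 2) * (∑ k, y k ^ 2))) :=
  (meanLE_layer_norms hw x y m hm).mono
    ((measurable_layerDot measurable_extParams x y m).pow_const 2) (fun _ => sq_nonneg _)
    fun _ => Finset.sum_mul_sq_le_sq_mul_sq _ _ _

/-- The off-mean part of the kernel recursion. -/
def kerDev (w : ℕ → ℕ) (θ : (l : ℕ) → Fin (w (l + 1)) → Fin (w l) → ℝ)
    (x y : Fin (w 0) → ℝ) (l : ℕ) (i j : Fin (w (l + 1))) : ℝ :=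
  rowDev ((w l : ℝ)⁻¹) (layerKer w θ x y l) (θ l) i j

/-- The squared Frobenius norm of the layer kernel. -/
def kerSq (w : ℕ → ℕ) (θ : (l : ℕ) → Fin (w (l + 1)) → Fin (w l) → ℝ)
    (x y : Fin (w 0) → ℝ) (l : ℕ) : ℝ :=
  ∑ i, ∑ j, layerKer w θ x y l i j ^ 2

theorem measurable_kerDev (x y : Fin (w 0) → ℝ) (m i j) :
    Measurable fun θ : Params L w => kerDev w (extParams θ) x y m i j :=
  measurable_rowDev_layerKer measurable_extParams x y _ m i j

theorem measurable_kerSq (x y : Fin (w 0) → ℝ) (m) :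
    Measurable fun θ : Params L w => kerSq w (extParams θ) x y m :=
  Finset.measurable_sum _ fun i _ => Finset.measurable_sum _ fun j _ =>
    (measurable_layerKer measurable_extParams x y m i j).pow_const 2

theorem kerSq_nonneg (θ : (l : ℕ) → Fin (w (l + 1)) → Fin (w l) → ℝ)
    (x y : Fin (w 0) → ℝ) (l : ℕ) : 0 ≤ kerSq w θ x y l := by
  unfold kerSq; positivity

theorem meanLE_kerDev_sq (x y : Fin (w 0) → ℝ) {m : ℕ} (hm : m < L) {β : ℝ}
    (hβ : MeanLE (initMeasure L w) (fun θ => kerSq w (extParams θ) x y m) β) (i j) :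
    MeanLE (initMeasure L w) (fun θ => kerDev w (extParams θ) x y m i j ^ 2)
      (2 * ((w m : ℝ)⁻¹) ^ 2 * β) := by
  refine MeanLE.of_update hm ((measurable_kerDev x y m i j).pow_const 2) (fun _ => sq_nonneg _)
    (hβ.const_mul (by positivity)) (fun θ W => ?_) fun θ => ?_
  · simp only [kerSq, layerKer_update]
  · simp only [kerDev, layerKer_update, extParams_update_self]
    simpa [kerSq] using lintegral_rowDev_sq_le (v := (w m : NNReal)⁻¹)
      (layerKer w (extParams θ) x y m) i j

theorem readoutKer_eq (θ : (l : ℕ) → Fin (w (l + 1)) → Fin (w l) → ℝ)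
    (x y : Fin (w 0) → ℝ) (l : ℕ) (i j : Fin (w (l + 1))) :
    readoutKer w θ x y l i j = (if i = j then layerDot w θ x y l +
      (w l : ℝ)⁻¹ * ∑ k, layerKer w θ x y l k k else 0) + kerDev w θ x y l i j := by
  unfold readoutKer kerDev rowDev
  split_ifs <;> ring

theorem kerSq_succ_le (hw : ∀ l, 0 < w l) (θ : (l : ℕ) → Fin (w (l + 1)) → Fin (w l) → ℝ)
    (x y : Fin (w 0) → ℝ) (l : ℕ) : kerSq w θ x y (l + 1) ≤
      3 * w (l + 1) * layerDot w θ x y l ^ 2 + 3 * (w (l + 1) * (w l : ℝ)⁻¹) * kerSq w θ x y l +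
      3 * ∑ i, ∑ j, kerDev w θ x y l i j ^ 2 := by
  have hb : (0 : ℝ) < w l := by exact_mod_cast hw l
  set q := layerDot w θ x y l
  set t := ∑ k, layerKer w θ x y l k k with ht
  have htr : t ^ 2 ≤ w l * kerSq w θ x y l := by
    have h1 : t ^ 2 ≤ (Finset.univ : Finset (Fin (w l))).card * ∑ k, layerKer w θ x y l k k ^ 2 :=
      sq_sum_le_card_mul_sum_sq
    rw [Finset.card_univ, Fintype.card_fin] at h1
    refine h1.trans (mul_le_mul_of_nonneg_left ?_ hb.le)
    exact Finset.sum_le_sum fun k _ =>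
      Finset.single_le_sum (f := fun j => layerKer w θ x y l k j ^ 2) (fun _ _ => sq_nonneg _)
        (Finset.mem_univ k)
  have hentry : ∀ i j, layerKer w θ x y (l + 1) i j ^ 2 ≤
      (if i = j then 3 * (q ^ 2 + ((w l : ℝ)⁻¹ * t) ^ 2) else 0) +
        3 * kerDev w θ x y l i j ^ 2 := by
    intro i j
    have h1 : layerKer w θ x y (l + 1) i j ^ 2 ≤ readoutKer w θ x y l i j ^ 2 := by
      rw [layerKer_succ]
      rcases gate_mem θ l x i with h | h <;> rcases gate_mem θ l y j with h' | h' <;>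
        simp [h, h', sq_nonneg]
    refine h1.trans ?_
    rw [readoutKer_eq, ← ht]
    split_ifs
    · set N := kerDev w θ x y l i j
      set s := (w l : ℝ)⁻¹ * t
      nlinarith [sq_nonneg (q - s), sq_nonneg (q - N), sq_nonneg (s - N)]
    · nlinarith [sq_nonneg (kerDev w θ x y l i j)]
  calc kerSq w θ x y (l + 1) ≤ ∑ i, ∑ j,
        ((if i = j then 3 * (q ^ 2 + ((w l : ℝ)⁻¹ * t) ^ 2) else 0) +
        3 * kerDev w θ x y l i j ^ 2) :=
        Finset.sum_le_sum fun i _ => Finset.sum_le_sum fun j _ => hentry i j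
    _ = w (l + 1) * (3 * (q ^ 2 + ((w l : ℝ)⁻¹ * t) ^ 2)) +
        3 * ∑ i, ∑ j, kerDev w θ x y l i j ^ 2 := by
        simp [Finset.sum_add_distrib, Finset.mul_sum]
    _ ≤ _ := by
        have h2 : ((w l : ℝ)⁻¹ * t) ^ 2 ≤ (w l : ℝ)⁻¹ * kerSq w θ x y l := by
          rw [mul_pow]
          calc _ ≤ ((w l : ℝ)⁻¹) ^ 2 * (w l * kerSq w θ x y l) := by gcongr
            _ = _ := by field_simp
        have h3 : (0 : ℝ) ≤ 3 * w (l + 1) := by positivity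
        nlinarith [mul_le_mul_of_nonneg_left h2 h3]

theorem meanLE_kerSq_succ (hw : ∀ l, 0 < w l) (x y : Fin (w 0) → ℝ) {m : ℕ} (hm : m < L) {β : ℝ}
    (hβ : MeanLE (initMeasure L w) (fun θ => kerSq w (extParams θ) x y m) β) :
    MeanLE (initMeasure L w) (fun θ => kerSq w (extParams θ) x y (m + 1))
      (3 * w (m + 1) * (3 ^ m * ((w m : ℝ) / w 0) ^ 2 * ((∑ k, x k ^ 2) * (∑ k, y k ^ 2))) +
        3 * (w (m + 1) * (w m : ℝ)⁻¹) * β +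
        3 * (w (m + 1) * (w (m + 1) * (2 * ((w m : ℝ)⁻¹) ^ 2 * β)))) := by
  have h1 := (meanLE_layerDot_sq hw x y hm.le).const_mul (c := 3 * w (m + 1)) (by positivity)
  have h2 := hβ.const_mul (c := 3 * (w (m + 1) * (w m : ℝ)⁻¹)) (by positivity)
  have hβ0 := hβ.bound_nonneg
  have h3 := (MeanLE.sum (by positivity) fun i => MeanLE.sum (by positivity) fun j =>
    meanLE_kerDev_sq x y hm hβ i j).const_mul (c := 3) (by norm_num)
  simp only [Fintype.card_fin] at h3
  exact ((h1.add h2).add h3).mono (measurable_kerSq x y _) (fun _ => kerSq_nonneg _ _ _ _)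
    fun θ => kerSq_succ_le hw _ x y m

/-- The negative part of the normalized trace of the layer kernel. -/
def kerTraceNeg (w : ℕ → ℕ) (θ : (l : ℕ) → Fin (w (l + 1)) → Fin (w l) → ℝ)
    (x y : Fin (w 0) → ℝ) (l : ℕ) : ℝ :=
  max (-((w l : ℝ)⁻¹ * ∑ k, layerKer w θ x y l k k)) 0

theorem layerDot_nonneg (θ : (l : ℕ) → Fin (w (l + 1)) → Fin (w l) → ℝ)
    (x y : Fin (w 0) → ℝ) {l : ℕ} (hl : 1 ≤ l) : 0 ≤ layerDot w θ x y l :=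
  Finset.sum_nonneg fun k _ => mul_nonneg (layerOut_nonneg θ x hl k) (layerOut_nonneg θ y hl k)

theorem neg_abs_le_layerDot (θ : (l : ℕ) → Fin (w (l + 1)) → Fin (w l) → ℝ)
    (x y : Fin (w 0) → ℝ) (l : ℕ) : -|∑ k, x k * y k| ≤ layerDot w θ x y l := by
  rcases Nat.eq_zero_or_pos l with rfl | hl
  · exact neg_abs_le _
  · exact (neg_nonpos.2 (abs_nonneg _)).trans (layerDot_nonneg θ x y hl)

theorem kerTraceNeg_succ_le (hw : ∀ l, 0 < w l) (θ : (l : ℕ) → Fin (w (l + 1)) → Fin (w l) → ℝ)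
    (x y : Fin (w 0) → ℝ) (l : ℕ) : kerTraceNeg w θ x y (l + 1) ≤ kerTraceNeg w θ x y l +
      |∑ k, x k * y k| + (w (l + 1) : ℝ)⁻¹ * ∑ i, |kerDev w θ x y l i i| := by
  have ha : (0 : ℝ) < w (l + 1) := by exact_mod_cast hw (l + 1)
  have hr : 0 ≤ kerTraceNeg w θ x y l := le_max_right _ _
  set c := kerTraceNeg w θ x y l + |∑ k, x k * y k| with hc
  have hc0 : 0 ≤ c := by positivity
  have hentry : ∀ i, -layerKer w θ x y (l + 1) i i ≤ c + |kerDev w θ x y l i i| := by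
    intro i
    have h1 : -readoutKer w θ x y l i i ≤ c + |kerDev w θ x y l i i| := by
      rw [readoutKer_eq, if_pos rfl]
      have h2 := neg_abs_le_layerDot θ x y l
      have h3 : -((w l : ℝ)⁻¹ * ∑ k, layerKer w θ x y l k k) ≤ kerTraceNeg w θ x y l :=
        le_max_left _ _
      have h4 := neg_abs_le (kerDev w θ x y l i i)
      linarith
    have h0 : 0 ≤ c + |kerDev w θ x y l i i| := by positivity
    rw [layerKer_succ]
    rcases gate_mem θ l x i with h | h <;> rcases gate_mem θ l y i with h' | h' <;>
      simp [h, h', h0]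
    linarith
  have hsum : -∑ i, layerKer w θ x y (l + 1) i i ≤
      w (l + 1) * c + ∑ i, |kerDev w θ x y l i i| := by
    rw [← Finset.sum_neg_distrib]
    refine (Finset.sum_le_sum fun i _ => hentry i).trans_eq ?_
    simp [Finset.sum_add_distrib]
  refine max_le ?_ (by positivity)
  calc -((w (l + 1) : ℝ)⁻¹ * ∑ i, layerKer w θ x y (l + 1) i i)
      = (w (l + 1) : ℝ)⁻¹ * -∑ i, layerKer w θ x y (l + 1) i i := by ring
    _ ≤ (w (l + 1) : ℝ)⁻¹ * (w (l + 1) * c + ∑ i, |kerDev w θ x y l i i|) := by gcongr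
    _ = _ := by field_simp

theorem kerTraceNeg_succ_sq_le (hw : ∀ l, 0 < w l)
    (θ : (l : ℕ) → Fin (w (l + 1)) → Fin (w l) → ℝ) (x y : Fin (w 0) → ℝ) (l : ℕ) :
    kerTraceNeg w θ x y (l + 1) ^ 2 ≤ 3 * kerTraceNeg w θ x y l ^ 2 +
      3 * (∑ k, x k * y k) ^ 2 + 3 * (w (l + 1) : ℝ)⁻¹ * ∑ i, kerDev w θ x y l i i ^ 2 := by
  have ha : (0 : ℝ) < w (l + 1) := by exact_mod_cast hw (l + 1)
  have h := kerTraceNeg_succ_le hw θ x y l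
  have h0 : 0 ≤ kerTraceNeg w θ x y (l + 1) := le_max_right _ _
  have hN : ((w (l + 1) : ℝ)⁻¹ * ∑ i, |kerDev w θ x y l i i|) ^ 2 ≤
      (w (l + 1) : ℝ)⁻¹ * ∑ i, kerDev w θ x y l i i ^ 2 := by
    have h1 := sq_sum_le_card_mul_sum_sq (s := Finset.univ) (f := fun i => |kerDev w θ x y l i i|)
    simp only [sq_abs, Finset.card_univ, Fintype.card_fin] at h1
    rw [mul_pow]
    calc _ ≤ ((w (l + 1) : ℝ)⁻¹) ^ 2 * (w (l + 1) * ∑ i, kerDev w θ x y l i i ^ 2) := by gcongr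
      _ = _ := by field_simp
  set p := kerTraceNeg w θ x y l
  set s := (w (l + 1) : ℝ)⁻¹ * ∑ i, |kerDev w θ x y l i i|
  rw [← sq_abs (∑ k, x k * y k)]
  set q := |∑ k, x k * y k|
  have h2 : kerTraceNeg w θ x y (l + 1) ^ 2 ≤ (p + q + s) ^ 2 := by gcongr
  nlinarith [sq_nonneg (q - s), sq_nonneg (q - p), sq_nonneg (s - p)]

theorem measurable_kerTraceNeg (x y : Fin (w 0) → ℝ) (m) :
    Measurable fun θ : Params L w => kerTraceNeg w (extParams θ) x y m :=
  ((Finset.measurable_sum _ fun k _ =>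
    measurable_layerKer measurable_extParams x y m k k).const_mul _).neg.max measurable_const

theorem meanLE_kerTraceNeg_sq_succ (hw : ∀ l, 0 < w l) (x y : Fin (w 0) → ℝ) {m : ℕ} (hm : m < L)
    {β γ : ℝ} (hβ : MeanLE (initMeasure L w) (fun θ => kerSq w (extParams θ) x y m) β)
    (hγ : MeanLE (initMeasure L w) (fun θ => kerTraceNeg w (extParams θ) x y m ^ 2) γ) :
    MeanLE (initMeasure L w) (fun θ => kerTraceNeg w (extParams θ) x y (m + 1) ^ 2)
      (3 * γ + 3 * (∑ k, x k * y k) ^ 2 + 3 * (2 * ((w m : ℝ)⁻¹) ^ 2 * β)) := by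
  have ha : (0 : ℝ) < w (m + 1) := by exact_mod_cast hw (m + 1)
  have hβ0 := hβ.bound_nonneg
  have h3 := (MeanLE.sum (by positivity) fun i => meanLE_kerDev_sq x y hm hβ i i).const_mul
    (c := 3 * (w (m + 1) : ℝ)⁻¹) (by positivity)
  have h12 := (hγ.const_mul (c := 3) (by norm_num)).add
    (MeanLE.const (μ := initMeasure L w) (c := 3 * (∑ k, x k * y k) ^ 2) (by positivity))
  refine ((h12.add h3).mono ((measurable_kerTraceNeg x y _).pow_const 2) (fun _ => sq_nonneg _)
    fun θ => kerTraceNeg_succ_sq_le hw _ x y m).weaken (le_of_eq ?_)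
  rw [Fintype.card_fin]
  field_simp

end Moments

section Width

variable {L n : ℕ}

theorem exists_meanLE_kerSq (L : ℕ) {P : ℝ} (hP : 0 ≤ P) : ∀ m : ℕ,
    ∃ c : ℝ, 0 ≤ c ∧ (m = 0 → c = 0) ∧ ∀ (n : ℕ) (w : ℕ → ℕ), 0 < n → (∀ l, 0 < w l) →
      (∀ l, 1 ≤ l → l < L → w l = n) → ∀ x y : Fin (w 0) → ℝ,
      (∑ k, x k ^ 2) * (∑ k, y k ^ 2) = P → m < L →
      MeanLE (initMeasure L w) (fun θ => kerSq w (extParams θ) x y m) (c * (n : ℝ) ^ 3)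
  | 0 => by
    refine ⟨0, le_rfl, fun _ => rfl, fun n w _ _ _ x y _ _ => ?_⟩
    rw [zero_mul]
    have : MeanLE (initMeasure L w) (fun _ => (0 : ℝ)) 0 := MeanLE.const le_rfl
    simpa [kerSq, layerKer] using this
  | m + 1 => by
    obtain ⟨c, hc, hc0, h⟩ := exists_meanLE_kerSq L hP m
    refine ⟨3 * (3 ^ m * P) + 9 * c, by positivity,
      fun h => by simp at h, fun n w hn hw hmid x y hxy hm => ?_⟩
    have hn' : (1 : ℝ) ≤ n := by exact_mod_cast hn
    have hn0 : (0 : ℝ) < n := by linarith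
    have hw0 : (0 : ℝ) < w 0 := by exact_mod_cast hw 0
    have hm' := Nat.lt_of_succ_lt hm
    have key := meanLE_kerSq_succ hw x y hm' (h n w hn hw hmid x y hxy hm')
    refine key.weaken ?_
    rw [hmid (m + 1) (Nat.le_add_left 1 m) hm, hxy]
    have hq : (w m : ℝ) / w 0 ≤ n := by
      rcases Nat.eq_zero_or_pos m with rfl | hm0
      · rwa [div_self hw0.ne']
      · rw [hmid m hm0 hm', div_le_iff₀ hw0]
        have : (1 : ℝ) ≤ w 0 := by exact_mod_cast hw 0
        nlinarith
    have t1 : 3 * (n : ℝ) * (3 ^ m * ((w m : ℝ) / w 0) ^ 2 * P) ≤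
        3 * n * (3 ^ m * (n : ℝ) ^ 2 * P) := by gcongr
    refine (add_le_add (add_le_add t1 le_rfl) le_rfl).trans ?_
    rcases Nat.eq_zero_or_pos m with hm0 | hm0
    · rw [hc0 hm0]
      refine le_of_eq ?_
      ring
    · rw [hmid m hm0 hm']
      have t2 : 3 * ((n : ℝ) * (n : ℝ)⁻¹) * (c * (n : ℝ) ^ 3) +
          3 * (n * (n * (2 * ((n : ℝ)⁻¹) ^ 2 * (c * (n : ℝ) ^ 3)))) = 9 * c * (n : ℝ) ^ 3 := by
        field_simp
        ring
      linarith

theorem exists_meanLE_kerTraceNeg_sq (L : ℕ) {P : ℝ} (hP : 0 ≤ P) (Q : ℝ) :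
    ∀ m : ℕ, ∃ c : ℝ, 0 ≤ c ∧ ∀ (n : ℕ) (w : ℕ → ℕ), 0 < n → (∀ l, 0 < w l) →
      (∀ l, 1 ≤ l → l < L → w l = n) → ∀ x y : Fin (w 0) → ℝ,
      (∑ k, x k ^ 2) * (∑ k, y k ^ 2) = P → ∑ k, x k * y k = Q → m < L →
      MeanLE (initMeasure L w)
        (fun θ => kerTraceNeg w (extParams θ) x y m ^ 2) (c * (n : ℝ))
  | 0 => by
    refine ⟨0, le_rfl, fun n w _ _ _ x y _ _ _ => ?_⟩
    rw [zero_mul]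
    have : MeanLE (initMeasure L w) (fun _ => (0 : ℝ)) 0 := MeanLE.const le_rfl
    simpa [kerTraceNeg, layerKer] using this
  | m + 1 => by
    obtain ⟨c, hc, h⟩ := exists_meanLE_kerTraceNeg_sq L hP Q m
    obtain ⟨b, hb, hb0, hβ⟩ := exists_meanLE_kerSq L hP m
    refine ⟨3 * c + 3 * Q ^ 2 + 6 * b, by positivity, fun n w hn hw hmid x y hxy hQ hm => ?_⟩
    have hn' : (1 : ℝ) ≤ n := by exact_mod_cast hn
    have hn0 : (0 : ℝ) < n := by linarith
    have hm' := Nat.lt_of_succ_lt hm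
    refine (meanLE_kerTraceNeg_sq_succ hw x y hm' (hβ n w hn hw hmid x y hxy hm')
      (h n w hn hw hmid x y hxy hQ hm')).weaken ?_
    rw [hQ]
    have t1 : Q ^ 2 ≤ Q ^ 2 * n := by
      nlinarith [sq_nonneg Q]
    have t2 : 3 * (2 * ((w m : ℝ)⁻¹) ^ 2 * (b * (n : ℝ) ^ 3)) ≤ 6 * b * n := by
      rcases Nat.eq_zero_or_pos m with hm0 | hm0
      · simp [hb0 hm0]
      · rw [hmid m hm0 hm']
        refine le_of_eq ?_
        field_simp
        ring
    nlinarith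

theorem exists_meanLE_kerDev_sq {P : ℝ} (hP : 0 ≤ P) (O m : ℕ) :
    ∃ c : ℝ, 0 ≤ c ∧ ∀ (n : ℕ) (w : ℕ → ℕ), 0 < n → (∀ l, 0 < w l) →
      (∀ l, 1 ≤ l → l < m + 2 → w l = n) → w (m + 2) = O → ∀ x y : Fin (w 0) → ℝ,
      (∑ k, x k ^ 2) * (∑ k, y k ^ 2) = P →
      MeanLE (initMeasure (m + 2) w)
        (fun θ => ∑ i, ∑ j, kerDev w (extParams θ) x y (m + 1) i j ^ 2) (c * (n : ℝ)) := by
  obtain ⟨b, hb, -, hβ⟩ := exists_meanLE_kerSq (m + 2) hP (m + 1)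
  refine ⟨O * (O * (2 * b)), by positivity, fun n w hn hw hmid hO x y hxy => ?_⟩
  have hn0 : (0 : ℝ) < n := by exact_mod_cast hn
  have hmL : m + 1 < m + 2 := by omega
  have h := MeanLE.sum (by positivity) fun i => MeanLE.sum (by positivity) fun j =>
    meanLE_kerDev_sq x y hmL (hβ n w hn hw hmid x y hxy hmL) i j
  refine h.weaken (le_of_eq ?_)
  rw [Fintype.card_fin, hO, hmid (m + 1) (by omega) hmL]
  field_simp

theorem measure_layerDot_succ_lt_le {w : ℕ → ℕ} (hw : ∀ l, 0 < w l) (x y : Fin (w 0) → ℝ) {m : ℕ}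
    (hm : m < L) :
    initMeasure L w {θ | 0 ≤ layerDot w (extParams θ) x y m ∧
      layerDot w (extParams θ) x y (m + 1) < w (m + 1) * ((w m : ℝ)⁻¹ *
        Real.sqrt ((∑ k, layerOut w (extParams θ) m x k ^ 2) *
          (∑ k, layerOut w (extParams θ) m y k ^ 2))) / 1024} ≤
      ENNReal.ofReal (12 * 512 ^ 2 / w (m + 1)) := by
  have hS : ∀ z, Measurable fun θ : Params L w => ∑ k, layerOut w (extParams θ) m z k ^ 2 :=
    fun z => Finset.measurable_sum _ fun k _ =>
      (measurable_layerOut measurable_extParams z m k).pow_const 2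
  refine initMeasure_le_of_forall hm ?_ fun θ => ?_
  · refine (measurableSet_le measurable_const
      (measurable_layerDot measurable_extParams x y m)).inter (measurableSet_lt
      (measurable_layerDot measurable_extParams x y (m + 1)) ?_)
    exact ((((hS x).mul (hS y)).sqrt.const_mul _).const_mul _).div_const _
  · simp only [Set.mem_ofPred_eq]
    simp only [layerDot, layerOut_update, layerOut_succ_update]
    by_cases h0 : 0 ≤ ∑ k, layerOut w (extParams θ) m x k * layerOut w (extParams θ) m y k
    · have h := measure_sum_relu_lt_sqrt_le (ι := Fin (w (m + 1))) (v := (w m : NNReal)⁻¹) h0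
        (by simpa using (hw m).ne') (by simpa using hw (m + 1))
      simpa [h0] using h
    · simp [h0]

theorem layerDot_self (w : ℕ → ℕ) (θ : (l : ℕ) → Fin (w (l + 1)) → Fin (w l) → ℝ)
    (x : Fin (w 0) → ℝ) (l : ℕ) : layerDot w θ x x l = ∑ k, layerOut w θ l x k ^ 2 := by
  simp only [layerDot, pow_two]

theorem measure_layerDot_self_lt_le {w : ℕ → ℕ} (hn : 0 < n) (hw : ∀ l, 0 < w l)
    (hmid : ∀ l, 1 ≤ l → l < L → w l = n) (x : Fin (w 0) → ℝ) :
    ∀ m, m < L → initMeasure L w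
      {θ | layerDot w (extParams θ) x x m < (w m : ℝ) / w 0 * ((1 / 1024) ^ m * ∑ k, x k ^ 2)} ≤
      ENNReal.ofReal (m * (12 * 512 ^ 2) / n)
  | 0, _ => by
    have hD' : (w 0 : ℝ) ≠ 0 := by exact_mod_cast (hw 0).ne'
    refine le_trans (le_of_eq ?_) zero_le
    convert! measure_empty (μ := initMeasure L w)
    ext θ
    simp only [Set.mem_ofPred_eq, Set.mem_empty_iff_false, iff_false, not_lt, layerDot_self]
    simp [layerOut, hD']
  | m + 1, hm => by
    have hn0 : (0 : ℝ) < n := by exact_mod_cast hn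
    have ih := measure_layerDot_self_lt_le hn hw hmid x m (Nat.lt_of_succ_lt hm)
    have h1 := measure_layerDot_succ_lt_le hw x x (Nat.lt_of_succ_lt hm)
    have hwn : (w (m + 1) : ℝ) = n := by
      rw [hmid (m + 1) (Nat.le_add_left 1 m) hm]
    refine le_trans (measure_mono ?_) ((measure_union_le _ _).trans
      ((add_le_add ih h1).trans_eq ?_))
    · intro θ hθ
      by_contra hcon
      simp only [Set.mem_union, Set.mem_ofPred_eq, not_or, not_lt, not_and] at hcon hθ
      obtain ⟨ha, hb⟩ := hcon
      have hb' := hb (by rw [layerDot_self]; positivity)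
      rw [← layerDot_self, Real.sqrt_mul_self (by rw [layerDot_self]; positivity)] at hb'
      have hwm : (0 : ℝ) < w m := by exact_mod_cast hw m
      have hD' : (0 : ℝ) < w 0 := by exact_mod_cast hw 0
      rw [hwn] at hb' hθ
      have : (n : ℝ) / w 0 * ((1 / 1024) ^ (m + 1) * ∑ k, x k ^ 2) ≤
          n * ((w m : ℝ)⁻¹ * layerDot w (extParams θ) x x m) / 1024 := by
        calc _ = n * ((w m : ℝ)⁻¹ * ((w m : ℝ) / w 0 *
              ((1 / 1024) ^ m * ∑ k, x k ^ 2))) / 1024 := by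
              field_simp
              ring
          _ ≤ _ := by gcongr
      linarith
    · rw [hwn, ← ENNReal.ofReal_add (by positivity) (by positivity)]
      congr 1
      push_cast
      ring

theorem sum_sq_pos {κ : Type*} [Fintype κ] {z : κ → ℝ} (hz : z ≠ 0) : 0 < ∑ k, z k ^ 2 := by
  obtain ⟨k, hk⟩ := Function.ne_iff.1 hz
  have hk' : z k ≠ 0 := hk
  exact Finset.sum_pos' (fun _ _ => sq_nonneg _) ⟨k, Finset.mem_univ _, by positivity⟩

/-- With one hidden layer, the inner product of the hidden representations is of order `n` with
high probability. -/
theorem measure_layerDot_one_lt_le {w : ℕ → ℕ} (hn : 0 < n) (hL : 0 < L) (hwn : w 1 = n)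
    (x y : Fin (w 0) → ℝ) {k : ℝ} (hk : 0 < k) (hxy : k ≤ reluCov ((w 0 : NNReal))⁻¹ x y) :
    initMeasure L w {θ | layerDot w (extParams θ) x y 1 < k / 2 * n} ≤
      ENNReal.ofReal (12 * (((w 0 : NNReal)⁻¹ : NNReal) ^ 2 *
      ((∑ k, x k ^ 2) * (∑ k, y k ^ 2))) / k ^ 2 / n) := by
  refine initMeasure_le_of_forall (m := 0) hL (measurableSet_lt
    (measurable_layerDot measurable_extParams x y 1) measurable_const) fun θ => ?_
  simp only [Set.mem_ofPred_eq]
  simp only [layerDot, layerOut, extParams_update_self]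
  have hn0 : (0 : ℝ) < n := by exact_mod_cast hn
  have h := measure_sum_relu_lt_le (ι := Fin (w (0 + 1))) (v := (w 0 : NNReal)⁻¹) x y hk hxy
    (by rw [Fintype.card_fin]; exact hwn ▸ hn)
  rw [Fintype.card_fin] at h
  have hwn' : ((w (0 + 1) : ℕ) : ℝ) = n := by rw [← hwn]
  rw [hwn'] at h
  have e : (n : ℝ) * k / 2 = k / 2 * n := by ring
  rw [e] at h
  refine h.trans_eq ?_
  congr 1
  field_simp

/-- With several hidden layers, the inner product of the last hidden representations is of order
`n` with high probability. -/
theorem measure_layerDot_lt_le {w : ℕ → ℕ} (hn : 0 < n) (hw : ∀ l, 0 < w l) {p : ℕ} (hp : 0 < p)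
    (hmid : ∀ l, 1 ≤ l → l < p + 2 → w l = n) (x y : Fin (w 0) → ℝ) :
    initMeasure (p + 2) w {θ | layerDot w (extParams θ) x y (p + 1) <
        Real.sqrt ((1 / 1024) ^ p * (∑ k, x k ^ 2) * ((1 / 1024) ^ p * (∑ k, y k ^ 2))) /
          w 0 / 1024 * n} ≤
      ENNReal.ofReal ((2 * p + 1) * (12 * 512 ^ 2) / n) := by
  have hD' : (0 : ℝ) < w 0 := by exact_mod_cast hw 0
  set X := ∑ k, x k ^ 2 with hXdef
  set Y := ∑ k, y k ^ 2 with hYdef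
  have hX : 0 ≤ X := by positivity
  have hY : 0 ≤ Y := by positivity
  have hn0 : (0 : ℝ) < n := by exact_mod_cast hn
  have hpL : p < p + 2 := by omega
  have h1 := measure_layerDot_self_lt_le hn hw hmid x p hpL
  have h2 := measure_layerDot_self_lt_le hn hw hmid y p hpL
  have h3 := measure_layerDot_succ_lt_le hw x y hpL
  have e1 : (w (p + 1) : ℝ) = n := by rw [hmid (p + 1) (by omega) (by omega)]
  have e0 : (w p : ℝ) = n := by rw [hmid p hp hpL]
  refine le_trans (measure_mono ?_) ((measure_union_le _ _).trans
    ((add_le_add ((measure_union_le _ _).trans (add_le_add h1 h2)) h3).trans_eq ?_))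
  · intro θ hθ
    by_contra hcon
    simp only [Set.mem_union, Set.mem_ofPred_eq, not_or, not_lt, not_and] at hcon hθ
    obtain ⟨⟨ha, hb⟩, hc⟩ := hcon
    have hc' := hc (layerDot_nonneg _ x y hp)
    rw [← layerDot_self, ← layerDot_self, e0, e1] at hc'
    rw [e0] at ha hb
    have : (n : ℝ) / w 0 * Real.sqrt ((1 / 1024) ^ p * X * ((1 / 1024) ^ p * Y)) ≤
        Real.sqrt (layerDot w (extParams θ) x x p * layerDot w (extParams θ) y y p) := by
      apply Real.le_sqrt_of_sq_le
      rw [mul_pow, Real.sq_sqrt (by positivity)]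
      calc _ = ((n : ℝ) / w 0 * ((1 / 1024) ^ p * X)) *
              ((n : ℝ) / w 0 * ((1 / 1024) ^ p * Y)) := by ring
        _ ≤ _ := mul_le_mul ha hb (by positivity) ((by positivity : (0 : ℝ) ≤ _).trans ha)
    set s := Real.sqrt ((1 / 1024) ^ p * X * ((1 / 1024) ^ p * Y))
    have e : s / w 0 / 1024 * n = n * ((n : ℝ)⁻¹ * (n / w 0 * s)) / 1024 := by
      field_simp
    rw [e] at hθ
    have : n * ((n : ℝ)⁻¹ * (n / w 0 * s)) / 1024 ≤ n * ((n : ℝ)⁻¹ *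
        Real.sqrt (layerDot w (extParams θ) x x p *
          layerDot w (extParams θ) y y p)) / 1024 := by gcongr
    linarith
  · rw [e1, ← ENNReal.ofReal_add (by positivity) (by positivity),
      ← ENNReal.ofReal_add (by positivity) (by positivity)]
    congr 1
    ring

theorem ae_preactivation_ne_zero {w : ℕ → ℕ} (hw : ∀ l, 0 < w l) (x : Fin (w 0) → ℝ) :
    ∀ᵐ θ ∂(initMeasure L w), ∀ m < L, layerOut w (extParams θ) m x ≠ 0 →
      ∀ i, ∑ j, extParams θ m i j * layerOut w (extParams θ) m x j ≠ 0 := by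
  refine ae_all_iff.2 fun m => ?_
  by_cases hm : m < L
  swap
  · exact Filter.Eventually.of_forall fun θ h => absurd h hm
  have hmeas : MeasurableSet {θ : Params L w | layerOut w (extParams θ) m x ≠ 0 ∧
      ∃ i, ∑ j, extParams θ m i j * layerOut w (extParams θ) m x j = 0} := by
    have h1 := measurable_layerOut (measurable_extParams (L := L) (w := w)) x m
    have h2 : MeasurableSet {θ : Params L w | layerOut w (extParams θ) m x = 0} :=
      (measurable_pi_lambda _ h1) (measurableSet_singleton 0)
    have h3 : {θ : Params L w | ∃ i, ∑ j, extParams θ m i j * layerOut w (extParams θ) m x j = 0} =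
        ⋃ i, {θ | ∑ j, extParams θ m i j * layerOut w (extParams θ) m x j = 0} := by
      ext θ
      simp
    refine h2.compl.inter ?_
    change MeasurableSet {θ : Params L w | ∃ i, _}
    rw [h3]
    exact MeasurableSet.iUnion fun i => (Finset.measurable_sum _ fun j _ =>
      (measurable_extParams m i j).mul (h1 j)) (measurableSet_singleton 0)
  have h0 := initMeasure_le_of_forall hm hmeas (p := 0) fun θ => ?_
  · filter_upwards [measure_eq_zero_iff_ae_notMem.1 (le_antisymm h0 zero_le)] with θ hθ _ hne i h
    exact hθ ⟨hne, i, h⟩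
  · simp only [Set.mem_ofPred_eq, layerOut_update, extParams_update_self]
    by_cases hz : layerOut w (extParams θ) m x = 0
    · simp [hz]
    · have := ae_rowLin_ne_zero (ι := Fin (w (m + 1))) (v := (w m : NNReal)⁻¹)
        (by simpa using (hw m).ne') hz
      refine le_of_eq (measure_mono_null ?_ this)
      rintro W ⟨-, i, hi⟩ h
      exact h i hi

end Width

theorem hasDerivAt_relu {t : ℝ} (ht : t ≠ 0) : HasDerivAt relu (if 0 < t then 1 else 0) t := by
  rcases lt_or_gt_of_ne ht with h | h
  · rw [if_neg h.le.not_gt]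
    refine (hasDerivAt_const t (0 : ℝ)).congr_of_eventuallyEq ?_
    filter_upwards [gt_mem_nhds h] with s hs
    exact max_eq_right (le_of_lt hs)
  · rw [if_pos h]
    refine (hasDerivAt_id t).congr_of_eventuallyEq ?_
    filter_upwards [lt_mem_nhds h] with s hs
    exact max_eq_left (le_of_lt hs)

section Gradient

variable {L : ℕ} {w : ℕ → ℕ}

/-- The weight `(m, i, j)` as a linear function of the parameters (zero beyond the last layer). -/
def weightCLM (L : ℕ) (w : ℕ → ℕ) (m : ℕ) (i : Fin (w (m + 1))) (j : Fin (w m)) :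
    Params L w →L[ℝ] ℝ :=
  if h : m < L then (ContinuousLinearMap.proj j).comp ((ContinuousLinearMap.proj i).comp
    (ContinuousLinearMap.proj (R := ℝ)
      (φ := fun l : Fin L => Fin (w (l.val + 1)) → Fin (w l.val) → ℝ) ⟨m, h⟩)) else 0

theorem weightCLM_apply (m : ℕ) (i : Fin (w (m + 1))) (j : Fin (w m)) (θ : Params L w) :
    weightCLM L w m i j θ = extParams θ m i j := by
  unfold weightCLM extParams
  split_ifs <;> rfl

/-- The derivative in the parameters of the hidden representation of layer `m`. -/
def layerGrad (θ : Params L w) (x : Fin (w 0) → ℝ) : (m : ℕ) → Fin (w m) → Params L w →L[ℝ] ℝ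
  | 0 => 0
  | m + 1 => fun i => gate w (extParams θ) m x i •
      ∑ j, (extParams θ m i j • layerGrad θ x m j +
        layerOut w (extParams θ) m x j • weightCLM L w m i j)

/-- The derivative in the parameters of the linear read-out of layer `m`. -/
def readoutGrad (θ : Params L w) (x : Fin (w 0) → ℝ) (m : ℕ) (i : Fin (w (m + 1))) :
    Params L w →L[ℝ] ℝ :=
  ∑ j, (extParams θ m i j • layerGrad θ x m j +
    layerOut w (extParams θ) m x j • weightCLM L w m i j)

theorem hasFDerivAt_readout {θ : Params L w} {x : Fin (w 0) → ℝ} {m : ℕ}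
    (h : ∀ j, HasFDerivAt (fun θ' : Params L w => layerOut w (extParams θ') m x j)
      (layerGrad θ x m j) θ) (i : Fin (w (m + 1))) :
    HasFDerivAt (fun θ' : Params L w => ∑ j, extParams θ' m i j *
      layerOut w (extParams θ') m x j) (readoutGrad θ x m i) θ := by
  refine HasFDerivAt.fun_sum fun j _ => ?_
  have hw : HasFDerivAt (fun θ' : Params L w => extParams θ' m i j) (weightCLM L w m i j) θ := by
    simp only [← weightCLM_apply]
    exact (weightCLM L w m i j).hasFDerivAt
  exact hw.mul (h j)

theorem hasFDerivAt_layerOut {θ : Params L w} {x : Fin (w 0) → ℝ} : ∀ {m : ℕ},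
    (∀ l < m, ∀ i, ∑ j, extParams θ l i j * layerOut w (extParams θ) l x j ≠ 0) → ∀ i,
    HasFDerivAt (fun θ' : Params L w => layerOut w (extParams θ') m x i) (layerGrad θ x m i) θ
  | 0, _, i => hasFDerivAt_const _ _
  | m + 1, h, i => by
    have ih := hasFDerivAt_readout
      (hasFDerivAt_layerOut fun l hl => h l (Nat.lt_succ_of_lt hl)) i
    exact (hasDerivAt_relu (h m (Nat.lt_succ_self m) i)).comp_hasFDerivAt θ ih

/-- The inner product of two linear functions of the parameters, in weight coordinates. -/
def gradDot (A B : Params L w →L[ℝ] ℝ) : ℝ :=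
  ∑ l : Fin L, ∑ a : Fin (w (l.val + 1)), ∑ b : Fin (w l.val),
    A (Pi.single l (Pi.single a (Pi.single b (1 : ℝ)))) *
      B (Pi.single l (Pi.single a (Pi.single b (1 : ℝ))))

theorem gradDot_comm (A B : Params L w →L[ℝ] ℝ) : gradDot A B = gradDot B A := by
  simp only [gradDot, mul_comm]

theorem gradDot_add_left (A B C : Params L w →L[ℝ] ℝ) :
    gradDot (A + B) C = gradDot A C + gradDot B C := by
  simp only [gradDot, add_apply, add_mul, Finset.sum_add_distrib]

theorem gradDot_smul_left (c : ℝ) (A C : Params L w →L[ℝ] ℝ) :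
    gradDot (c • A) C = c * gradDot A C := by
  simp only [gradDot, smul_apply, smul_eq_mul, mul_assoc, Finset.mul_sum]

theorem gradDot_zero_left (C : Params L w →L[ℝ] ℝ) : gradDot 0 C = 0 := by
  simp [gradDot]

theorem gradDot_sum_left {ι : Type*} (s : Finset ι) (A : ι → Params L w →L[ℝ] ℝ)
    (C : Params L w →L[ℝ] ℝ) : gradDot (∑ i ∈ s, A i) C = ∑ i ∈ s, gradDot (A i) C := by
  induction s using Finset.cons_induction with
  | empty => simp [gradDot_zero_left]
  | cons a s ha ih => rw [Finset.sum_cons, Finset.sum_cons, gradDot_add_left, ih]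

theorem gradDot_add_right (A B C : Params L w →L[ℝ] ℝ) :
    gradDot C (A + B) = gradDot C A + gradDot C B := by
  rw [gradDot_comm, gradDot_add_left, gradDot_comm A, gradDot_comm B]

theorem gradDot_smul_right (c : ℝ) (A C : Params L w →L[ℝ] ℝ) :
    gradDot C (c • A) = c * gradDot C A := by
  rw [gradDot_comm, gradDot_smul_left, gradDot_comm]

theorem gradDot_sum_right {ι : Type*} (s : Finset ι) (A : ι → Params L w →L[ℝ] ℝ)
    (C : Params L w →L[ℝ] ℝ) : gradDot C (∑ i ∈ s, A i) = ∑ i ∈ s, gradDot C (A i) := by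
  rw [gradDot_comm, gradDot_sum_left]
  exact Finset.sum_congr rfl fun i _ => gradDot_comm _ _

theorem gradDot_weightCLM (A : Params L w →L[ℝ] ℝ) {m : ℕ} (h : m < L) (i : Fin (w (m + 1)))
    (j : Fin (w m)) : gradDot A (weightCLM L w m i j) =
      A (Pi.single ⟨m, h⟩ (Pi.single i (Pi.single j (1 : ℝ)))) := by
  unfold gradDot
  simp only [weightCLM_apply, extParams_of_lt _ h]
  rw [Fintype.sum_eq_single (⟨m, h⟩ : Fin L)]
  · rw [Fintype.sum_eq_single i, Fintype.sum_eq_single j]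
    · simp
    · intro b hb
      simp [Pi.single_eq_of_ne hb.symm]
    · intro a ha
      simp [Pi.single_eq_of_ne ha.symm]
  · intro l hl
    simp [Pi.single_eq_of_ne hl.symm]

theorem weightCLM_single_of_ne {m l : ℕ} (h : l < L) (hml : m ≠ l) (i : Fin (w (m + 1)))
    (j : Fin (w m)) (W : Fin (w (l + 1)) → Fin (w l) → ℝ) :
    weightCLM L w m i j (Pi.single ⟨l, h⟩ W) = 0 := by
  rw [weightCLM_apply]
  unfold extParams
  split_ifs with hm
  · rw [Pi.single_eq_of_ne (by simpa using hml)]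
    rfl
  · rfl

theorem layerGrad_single_of_le (θ : Params L w) (x : Fin (w 0) → ℝ) {l : ℕ} (h : l < L)
    (W : Fin (w (l + 1)) → Fin (w l) → ℝ) : ∀ {m : ℕ}, m ≤ l → ∀ i,
    layerGrad θ x m i (Pi.single ⟨l, h⟩ W) = 0
  | 0, _, i => rfl
  | m + 1, hm, i => by
    simp only [layerGrad, smul_apply, sum_apply,
      add_apply, layerGrad_single_of_le θ x h W (Nat.le_of_succ_le hm),
      weightCLM_single_of_ne h (Nat.ne_of_lt hm)]
    simp

theorem gradDot_layerGrad_weightCLM (θ : Params L w) (x : Fin (w 0) → ℝ) {m : ℕ} (h : m < L)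
    (k j : Fin (w m)) (i : Fin (w (m + 1))) :
    gradDot (layerGrad θ x m k) (weightCLM L w m i j) = 0 := by
  rw [gradDot_weightCLM _ h, layerGrad_single_of_le θ x h _ le_rfl]

theorem gradDot_weightCLM_weightCLM {m : ℕ} (h : m < L) (i i' : Fin (w (m + 1)))
    (j j' : Fin (w m)) : gradDot (weightCLM L w m i j) (weightCLM L w m i' j') =
      if i = i' then if j = j' then 1 else 0 else 0 := by
  rw [gradDot_weightCLM _ h, weightCLM_apply, extParams_of_lt _ h, Pi.single_eq_same]
  simp only [Pi.single_apply]
  split_ifs <;> simp_all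

theorem gradDot_readoutGrad_of_layerGrad (θ : Params L w) (x y : Fin (w 0) → ℝ) {m : ℕ}
    (h : m < L) (hm : ∀ i j, gradDot (layerGrad θ x m i) (layerGrad θ y m j) =
      layerKer w (extParams θ) x y m i j) (i j : Fin (w (m + 1))) :
    gradDot (readoutGrad θ x m i) (readoutGrad θ y m j) =
      readoutKer w (extParams θ) x y m i j := by
  have h1 : ∀ k l, gradDot (weightCLM L w m i k) (layerGrad θ y m l) = 0 := fun k l => by
    rw [gradDot_comm, gradDot_layerGrad_weightCLM θ y h]
  simp only [readoutGrad, gradDot_sum_left, gradDot_add_left, gradDot_smul_left,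
    gradDot_sum_right, gradDot_add_right, gradDot_smul_right, hm, h1,
    gradDot_layerGrad_weightCLM θ x h, gradDot_weightCLM_weightCLM h]
  simp only [readoutKer, layerDot, rowForm]
  simp only [mul_zero, add_zero, zero_add, Finset.sum_add_distrib]
  rw [add_comm]
  congr 1
  · split_ifs
    · simp [mul_comm]
    · simp
  · rw [Finset.sum_comm]
    refine Finset.sum_congr rfl fun k _ => ?_
    rw [← Finset.sum_mul, mul_comm]

theorem gradDot_layerGrad (θ : Params L w) (x y : Fin (w 0) → ℝ) : ∀ {m : ℕ}, m ≤ L → ∀ i j,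
    gradDot (layerGrad θ x m i) (layerGrad θ y m j) = layerKer w (extParams θ) x y m i j
  | 0, _, i, j => gradDot_zero_left _
  | m + 1, h, i, j => by
    have ih := gradDot_readoutGrad_of_layerGrad θ x y h
      (gradDot_layerGrad θ x y (Nat.le_of_succ_le h)) i j
    rw [layerKer_succ, ← ih]
    change gradDot (gate w (extParams θ) m x i • readoutGrad θ x m i)
      (gate w (extParams θ) m y j • readoutGrad θ y m j) = _
    rw [gradDot_smul_left, gradDot_smul_right, mul_assoc]

theorem gradDot_readoutGrad (θ : Params L w) (x y : Fin (w 0) → ℝ) {m : ℕ} (h : m < L)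
    (i j : Fin (w (m + 1))) : gradDot (readoutGrad θ x m i) (readoutGrad θ y m j) =
      readoutKer w (extParams θ) x y m i j :=
  gradDot_readoutGrad_of_layerGrad θ x y h (gradDot_layerGrad θ x y h.le) i j

theorem hasFDerivAt_fnet {m : ℕ} {θ : Params (m + 1) w} {x : Fin (w 0) → ℝ}
    (h : ∀ l < m, ∀ i, ∑ j, extParams θ l i j * layerOut w (extParams θ) l x j ≠ 0)
    (i : Fin (w (m + 1))) :
    HasFDerivAt (fun θ' : Params (m + 1) w => fnet (m + 1) w θ' x i) (readoutGrad θ x m i) θ :=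
  hasFDerivAt_readout (hasFDerivAt_layerOut h) i

theorem eNTK_eq_readoutKer {m : ℕ} {θ : Params (m + 1) w} {x y : Fin (w 0) → ℝ}
    (hx : ∀ l < m, ∀ i, ∑ j, extParams θ l i j * layerOut w (extParams θ) l x j ≠ 0)
    (hy : ∀ l < m, ∀ i, ∑ j, extParams θ l i j * layerOut w (extParams θ) l y j ≠ 0)
    (i j : Fin (w (m + 1))) :
    eNTK (m + 1) w θ x y i j = readoutKer w (extParams θ) x y m i j := by
  rw [← gradDot_readoutGrad θ x y (Nat.lt_succ_self m)]
  simp only [eNTK, pderiv, (hasFDerivAt_fnet hx i).fderiv, (hasFDerivAt_fnet hy j).fderiv]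
  rfl

theorem pNTK_eq_sum_readoutKer {m : ℕ} {θ : Params (m + 1) w} {x y : Fin (w 0) → ℝ}
    (hx : ∀ l < m, ∀ i, ∑ j, extParams θ l i j * layerOut w (extParams θ) l x j ≠ 0)
    (hy : ∀ l < m, ∀ i, ∑ j, extParams θ l i j * layerOut w (extParams θ) l y j ≠ 0) :
    pNTK (m + 1) w θ x y = (w (m + 1) : ℝ)⁻¹ *
      ∑ i, ∑ j, readoutKer w (extParams θ) x y m i j := by
  have key : ∀ {z : Fin (w 0) → ℝ},
      (∀ l < m, ∀ i, ∑ j, extParams θ l i j * layerOut w (extParams θ) l z j ≠ 0) →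
      fderiv ℝ (fun θ' : Params (m + 1) w =>
        (Real.sqrt (w (m + 1)))⁻¹ * ∑ i, fnet (m + 1) w θ' z i) θ =
        (Real.sqrt (w (m + 1)))⁻¹ • ∑ i, readoutGrad θ z m i := fun hz =>
    ((HasFDerivAt.fun_sum fun i _ => hasFDerivAt_fnet hz i).const_mul _).fderiv
  simp only [← gradDot_readoutGrad θ x y (Nat.lt_succ_self m)]
  have h2 : ∑ i, ∑ j, gradDot (readoutGrad θ x m i) (readoutGrad θ y m j) =
      gradDot (∑ i, readoutGrad θ x m i) (∑ i, readoutGrad θ y m i) := by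
    simp only [gradDot_sum_left, gradDot_sum_right]
    exact Finset.sum_comm
  rw [h2]
  have h3 : (w (m + 1) : ℝ)⁻¹ = (Real.sqrt (w (m + 1)))⁻¹ * (Real.sqrt (w (m + 1)))⁻¹ := by
    rw [← mul_inv, Real.mul_self_sqrt (by positivity)]
  rw [h3, mul_assoc, ← gradDot_smul_right, ← gradDot_smul_left, ← key hx, ← key hy]
  rfl

end Gradient

section Spectrum

variable {k : Type*} [Fintype k] [DecidableEq k]

theorem lambdaMax_smul_one [Nonempty k] (p : ℝ) : lambdaMax (p • (1 : Matrix k k ℝ)) = p := by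
  unfold lambdaMax
  rw [← Algebra.algebraMap_eq_smul_one, spectrum.scalar_eq, csSup_singleton]

theorem abs_sub_le_of_mem_spectrum {M : Matrix k k ℝ} {s ε : ℝ}
    (h : ∀ i j, |M i j - if i = j then s else 0| ≤ ε) {a : ℝ} (ha : a ∈ spectrum ℝ M) :
    |a - s| ≤ Fintype.card k * ε := by
  rw [← Matrix.spectrum_toLin', ← Module.End.hasEigenvalue_iff_mem_spectrum] at ha
  obtain ⟨i, hi⟩ := eigenvalue_mem_ball ha
  rw [Metric.mem_closedBall, Real.dist_eq] at hi
  have h1 : ∑ j ∈ Finset.univ.erase i, ‖M i j‖ ≤ ∑ j ∈ Finset.univ.erase i, ε := by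
    refine Finset.sum_le_sum fun j hj => ?_
    have := h i j
    rwa [if_neg (Finset.ne_of_mem_erase hj).symm, sub_zero] at this
  have h2 : |M i i - s| ≤ ε := by simpa using h i i
  calc |a - s| ≤ |a - M i i| + |M i i - s| := abs_sub_le _ _ _
    _ ≤ (∑ j ∈ Finset.univ.erase i, ε) + ε := add_le_add (hi.trans h1) h2
    _ = ∑ j, ε := Finset.sum_erase_add _ _ (Finset.mem_univ i)
    _ = _ := by simp

theorem abs_sub_lambdaMax_div_le {M : Matrix k k ℝ} {s ε p : ℝ} (hs : 0 < s)
    (h : ∀ i j, |M i j - if i = j then s else 0| ≤ ε) (hp : |p - s| ≤ Fintype.card k * ε)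
    (hε : 2 * (Fintype.card k * ε) ≤ s) :
    |p - lambdaMax M| / lambdaMax M ≤ 4 * (Fintype.card k * ε) / s := by
  have hε0 : 0 ≤ Fintype.card k * ε := (abs_nonneg _).trans hp
  rcases (spectrum ℝ M).eq_empty_or_nonempty with he | hne
  · have : lambdaMax M = 0 := by rw [lambdaMax, he, Real.sSup_empty]
    rw [this, div_zero]
    positivity
  · have hb : ∀ a ∈ spectrum ℝ M, |a - s| ≤ Fintype.card k * ε :=
      fun a ha => abs_sub_le_of_mem_spectrum h ha
    have hu : lambdaMax M ≤ s + Fintype.card k * ε :=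
      csSup_le hne fun a ha => by linarith [(abs_le.1 (hb a ha)).2]
    have hl : s - Fintype.card k * ε ≤ lambdaMax M := by
      obtain ⟨a, ha⟩ := hne
      refine le_trans ?_ (le_csSup ⟨s + Fintype.card k * ε, fun b hb' => ?_⟩ ha)
      · linarith [(abs_le.1 (hb a ha)).1]
      · linarith [(abs_le.1 (hb b hb')).2]
    have hp' := abs_le.1 hp
    have h1 : |p - lambdaMax M| ≤ 2 * (Fintype.card k * ε) := by
      rw [abs_le]
      constructor <;> linarith
    have h2 : s / 2 ≤ lambdaMax M := by linarith
    calc |p - lambdaMax M| / lambdaMax M ≤ 2 * (Fintype.card k * ε) / (s / 2) := by gcongr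
      _ = _ := by field_simp; ring

end Spectrum

section Ratio

variable {w : ℕ → ℕ}

theorem layerOut_eq_zero_of_le (θ : (l : ℕ) → Fin (w (l + 1)) → Fin (w l) → ℝ)
    {x : Fin (w 0) → ℝ} {l m : ℕ} (hlm : l ≤ m) (h : layerOut w θ l x = 0) :
    layerOut w θ m x = 0 := by
  induction m, hlm using Nat.le_induction with
  | base => exact h
  | succ m _ ih =>
    ext i
    simp [layerOut, ih, relu]

theorem layerOut_ne_zero_of_layerDot_pos {θ : (l : ℕ) → Fin (w (l + 1)) → Fin (w l) → ℝ}
    {x y : Fin (w 0) → ℝ} {m : ℕ} (h : 0 < layerDot w θ x y m) {l : ℕ} (hl : l ≤ m) :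
    layerOut w θ l x ≠ 0 ∧ layerOut w θ l y ≠ 0 := by
  constructor <;> intro h0 <;>
  · have := layerOut_eq_zero_of_le θ hl h0
    simp [layerDot, this] at h

/-- The relative error of the largest eigenvalue, for parameters at which the last hidden
representations are well correlated and the kernel is nearly a multiple of the identity. -/
theorem ratio_le {p : ℕ} {θ : Params (p + 2) w} {x y : Fin (w 0) → ℝ} (hO : 0 < w (p + 2))
    (hx : ∀ m < p + 2, layerOut w (extParams θ) m x ≠ 0 →
      ∀ i, ∑ j, extParams θ m i j * layerOut w (extParams θ) m x j ≠ 0)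
    (hy : ∀ m < p + 2, layerOut w (extParams θ) m y ≠ 0 →
      ∀ i, ∑ j, extParams θ m i j * layerOut w (extParams θ) m y j ≠ 0)
    {ε s₀ : ℝ} (hs₀ : 0 < s₀) (hε : 2 * (w (p + 2) * ε) ≤ s₀)
    (hq : s₀ + ε ≤ layerDot w (extParams θ) x y (p + 1))
    (hr : kerTraceNeg w (extParams θ) x y (p + 1) ≤ ε)
    (hN : ∀ i j, |kerDev w (extParams θ) x y (p + 1) i j| ≤ ε) :
    |lambdaMax (pNTK (p + 2) w θ x y • (1 : Matrix (Fin (w (p + 2))) (Fin (w (p + 2))) ℝ)) -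
      lambdaMax (eNTK (p + 2) w θ x y)| / lambdaMax (eNTK (p + 2) w θ x y) ≤
      4 * (w (p + 2) * ε) / s₀ := by
  have hne : Nonempty (Fin (w (p + 2))) := ⟨⟨0, hO⟩⟩
  have hε0 : 0 ≤ ε := (le_max_right _ _).trans hr
  have hq0 : 0 < layerDot w (extParams θ) x y (p + 1) := by linarith
  have hx' : ∀ l < p + 1, ∀ i, ∑ j, extParams θ l i j * layerOut w (extParams θ) l x j ≠ 0 :=
    fun l hl => hx l (by omega) (layerOut_ne_zero_of_layerDot_pos hq0 hl.le).1
  have hy' : ∀ l < p + 1, ∀ i, ∑ j, extParams θ l i j * layerOut w (extParams θ) l y j ≠ 0 :=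
    fun l hl => hy l (by omega) (layerOut_ne_zero_of_layerDot_pos hq0 hl.le).2
  set s := layerDot w (extParams θ) x y (p + 1) +
      (w (p + 1) : ℝ)⁻¹ * ∑ k, layerKer w (extParams θ) x y (p + 1) k k with hs
  have hss : s₀ ≤ s := by
    have : -((w (p + 1) : ℝ)⁻¹ * ∑ k, layerKer w (extParams θ) x y (p + 1) k k) ≤ ε :=
      (le_max_left _ _).trans hr
    linarith
  have hcard : ((Fintype.card (Fin (w (p + 2))) : ℕ) : ℝ) = w (p + 2) := by
    rw [Fintype.card_fin]
  have hO' : (0 : ℝ) < w (p + 2) := by exact_mod_cast hO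
  rw [lambdaMax_smul_one]
  have key := abs_sub_lambdaMax_div_le (M := eNTK (p + 2) w θ x y) (s := s) (ε := ε)
    (p := pNTK (p + 2) w θ x y) (by linarith) (fun i j => ?_) ?_ ?_
  · rw [hcard] at key
    refine key.trans ?_
    gcongr
  · rw [eNTK_eq_readoutKer hx' hy', readoutKer_eq]
    simpa [hs] using hN i j
  · have hsum : ∑ i, ∑ j, readoutKer w (extParams θ) x y (p + 1) i j =
        w (p + 2) * s + ∑ i, ∑ j, kerDev w (extParams θ) x y (p + 1) i j := by
      simp only [readoutKer_eq, Finset.sum_add_distrib, Finset.sum_ite_eq, Finset.mem_univ, if_true,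
        ← hs, Finset.sum_const, Finset.card_univ, hcard, nsmul_eq_mul]
    rw [pNTK_eq_sum_readoutKer hx' hy', hsum, hcard]
    have hb : |∑ i, ∑ j, kerDev w (extParams θ) x y (p + 1) i j| ≤
        w (p + 2) * (w (p + 2) * ε) := by
      refine (Finset.abs_sum_le_sum_abs _ _).trans ?_
      refine (Finset.sum_le_sum fun i _ => (Finset.abs_sum_le_sum_abs _ _).trans
        (Finset.sum_le_sum fun j _ => hN i j)).trans_eq ?_
      simp
    have e : (w (p + 1 + 1) : ℝ)⁻¹ * (w (p + 2) * s +
        ∑ i, ∑ j, kerDev w (extParams θ) x y (p + 1) i j) - s =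
        (w (p + 2) : ℝ)⁻¹ * ∑ i, ∑ j, kerDev w (extParams θ) x y (p + 1) i j := by
      field_simp
      ring
    rw [e, abs_mul, abs_of_nonneg (by positivity)]
    refine (mul_le_mul_of_nonneg_left hb (by positivity)).trans_eq ?_
    field_simp
  · rw [hcard]
    linarith

theorem ofReal_one_sub_le_measure {Ω : Type*} [MeasurableSpace Ω] {μ : Measure Ω}
    [IsProbabilityMeasure μ] {A : Set Ω} {δ : ℝ} (hδ : 0 ≤ δ) (h : μ Aᶜ ≤ ENNReal.ofReal δ) :
    ENNReal.ofReal (1 - δ) ≤ μ A := by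
  rw [ENNReal.ofReal_sub _ hδ, ENNReal.ofReal_one, tsub_le_iff_right]
  calc (1 : ENNReal) = μ (A ∪ Aᶜ) := by rw [Set.union_compl_self, measure_univ]
    _ ≤ μ A + μ Aᶜ := measure_union_le _ _
    _ ≤ _ := by gcongr

theorem abs_le_sqrt_of_not_le {t r : ℝ} (h : ¬ t ≤ r ^ 2) : |r| ≤ Real.sqrt t :=
  Real.abs_le_sqrt (not_le.1 h).le

theorem exists_ratio_le {P : ℝ} (hP : 0 ≤ P) (Q : ℝ) {O : ℕ} (hO : 0 < O) (p : ℕ) {c K δ : ℝ}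
    (hc : 0 < c) (hδ : 0 < δ) :
    ∃ (n₀ : ℕ) (C : ℝ), ∀ (n : ℕ) (w : ℕ → ℕ), n₀ < n → (∀ l, 0 < w l) →
      (∀ l, 1 ≤ l → l < p + 2 → w l = n) → w (p + 2) = O → ∀ x y : Fin (w 0) → ℝ,
      (∑ k, x k ^ 2) * (∑ k, y k ^ 2) = P → ∑ k, x k * y k = Q →
      initMeasure (p + 2) w {θ | layerDot w (extParams θ) x y (p + 1) < c * n} ≤
        ENNReal.ofReal (K / n) →
      ENNReal.ofReal (1 - δ) ≤ initMeasure (p + 2) w {θ : Params (p + 2) w |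
        |lambdaMax (pNTK (p + 2) w θ x y • (1 : Matrix (Fin (w (p + 2))) (Fin (w (p + 2))) ℝ)) -
          lambdaMax (eNTK (p + 2) w θ x y)| / lambdaMax (eNTK (p + 2) w θ x y) ≤
        C / Real.sqrt n} := by
  obtain ⟨a, ha, hA⟩ := exists_meanLE_kerTraceNeg_sq (p + 2) hP Q (p + 1)
  obtain ⟨b, hb, hB⟩ := exists_meanLE_kerDev_sq hP O p
  set t := 3 * (a + b + 1) / δ with ht
  have ht0 : 0 < t := by positivity
  have hOr : (1 : ℝ) ≤ O := by exact_mod_cast hO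
  refine ⟨⌈3 * K / δ⌉₊ + ⌈(4 * O * Real.sqrt t / c) ^ 2⌉₊, 8 * O * Real.sqrt t / c,
    fun n w hn hw hmid hwO x y hxy hQ hq => ?_⟩
  have hn1 : 3 * K / δ ≤ n := (Nat.le_ceil _).trans (Nat.cast_le.2 (by omega))
  have hn2 : (4 * O * Real.sqrt t / c) ^ 2 ≤ n :=
    (Nat.le_ceil _).trans (Nat.cast_le.2 (by omega))
  have hnpos : 0 < n := by omega
  have hn0 : (0 : ℝ) < n := by exact_mod_cast hnpos
  have hsq : 4 * O * Real.sqrt t ≤ c * Real.sqrt n := by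
    have := Real.le_sqrt_of_sq_le hn2
    rwa [div_le_iff₀ hc, mul_comm _ c] at this
  have hsn : 0 < Real.sqrt n := Real.sqrt_pos.2 hn0
  have hnn : Real.sqrt n * Real.sqrt n = n := Real.mul_self_sqrt hn0.le
  have htn : 0 < t * n := by positivity
  have hr := (hA n w hnpos hw hmid x y hxy hQ (by omega)).measure_ge_le htn
  have hN := (hB n w hnpos hw hmid hwO x y hxy).measure_ge_le htn
  have hgx := ae_iff.1 (ae_preactivation_ne_zero (L := p + 2) hw x)
  have hgy := ae_iff.1 (ae_preactivation_ne_zero (L := p + 2) hw y)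
  refine ofReal_one_sub_le_measure hδ.le ?_
  refine le_trans (measure_mono ?_) ((measure_union_le _ _).trans
    ((add_le_add ((measure_union_le _ _).trans (add_le_add hq
      ((measure_union_le _ _).trans (add_le_add hr hN))))
      ((measure_union_le _ _).trans (add_le_add hgx.le hgy.le))).trans ?_))
  · intro θ hθ
    by_contra hcon
    simp only [Set.mem_union, Set.mem_ofPred_eq, not_or, not_not, not_lt] at hcon
    obtain ⟨⟨h1, h2, h3⟩, h4, h5⟩ := hcon
    refine hθ ?_
    have hε : Real.sqrt (t * n) = Real.sqrt t * Real.sqrt n := Real.sqrt_mul ht0.le _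
    have hst : 0 ≤ Real.sqrt t := Real.sqrt_nonneg t
    have e1 : 4 * O * Real.sqrt t * Real.sqrt n ≤ c * n := by
      calc _ ≤ c * Real.sqrt n * Real.sqrt n := by gcongr
        _ = _ := by rw [mul_assoc, hnn]
    have e2 : Real.sqrt t * Real.sqrt n ≤ O * (Real.sqrt t * Real.sqrt n) :=
      le_mul_of_one_le_left (by positivity) hOr
    have e3 : 0 < c * n := by positivity
    have key := ratio_le (θ := θ) (x := x) (y := y) (hwO ▸ hO) h4 h5 (ε := Real.sqrt (t * n))
      (s₀ := c * n / 2) (by positivity) (by rw [hε, hwO]; linarith) (by rw [hε]; linarith)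
      ((le_abs_self _).trans (abs_le_sqrt_of_not_le h2)) (fun i j => ?_)
    · refine key.trans_eq ?_
      rw [hε, hwO]
      nth_rewrite 2 [← hnn]
      field_simp
      ring
    · refine abs_le_sqrt_of_not_le fun hle => h3 (hle.trans ?_)
      exact (Finset.single_le_sum (f := fun j => kerDev w (extParams θ) x y (p + 1) i j ^ 2)
        (fun j _ => sq_nonneg _) (Finset.mem_univ j)).trans
        (Finset.single_le_sum (f := fun i => ∑ j, kerDev w (extParams θ) x y (p + 1) i j ^ 2)
          (fun i _ => Finset.sum_nonneg fun j _ => sq_nonneg _) (Finset.mem_univ i))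
  · have f1 : K / n ≤ δ / 3 := by
      rw [div_le_iff₀ hδ] at hn1
      rw [div_le_iff₀ hn0]
      linarith
    have f2 : a * n / (t * n) + b * n / (t * n) ≤ δ / 3 := by
      rw [ht]
      rw [← add_div, div_le_iff₀ htn, ht]
      have : δ / 3 * (3 * (a + b + 1) / δ * n) = (a + b + 1) * n := by field_simp
      rw [this]
      linarith
    rw [add_zero, add_zero]
    rw [← ENNReal.ofReal_add (by positivity) (by positivity)]
    calc _ ≤ ENNReal.ofReal (δ / 3) + ENNReal.ofReal (δ / 3) := by gcongr
      _ = ENNReal.ofReal (δ / 3 + δ / 3) := (ENNReal.ofReal_add (by positivity) (by positivity)).symm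
      _ ≤ _ := ENNReal.ofReal_le_ofReal (by linarith)

theorem ratio_le_of_ae_eq_zero {L n : ℕ} (x y : Fin (w 0) → ℝ) {δ : ℝ} (hδ : 0 < δ)
    (h : ∀ᵐ θ ∂(initMeasure L w), eNTK L w θ x y = 0 ∧ pNTK L w θ x y = 0) :
    ENNReal.ofReal (1 - δ) ≤ initMeasure L w {θ : Params L w |
        |lambdaMax (pNTK L w θ x y • (1 : Matrix (Fin (w L)) (Fin (w L)) ℝ)) -
          lambdaMax (eNTK L w θ x y)| / lambdaMax (eNTK L w θ x y) ≤ 0 / Real.sqrt n} := by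
  refine ofReal_one_sub_le_measure hδ.le (le_trans (le_of_eq ?_) zero_le)
  rw [measure_eq_zero_iff_ae_notMem]
  filter_upwards [h] with θ hθ hmem
  refine hmem ?_
  simp [hθ.1, hθ.2]

theorem fnet_zero {L : ℕ} (hL : 0 < L) (θ : Params L w) (i : Fin (w L)) : fnet L w θ 0 i = 0 := by
  obtain ⟨L, rfl⟩ := Nat.exists_eq_add_of_le' hL
  have h : layerOut w (extParams θ) L 0 = 0 := layerOut_eq_zero_of_le _ (Nat.zero_le L) rfl
  simp [fnet, netOut, h]

theorem kernels_eq_zero_of_input_eq_zero {L : ℕ} (hL : 0 < L) (θ : Params L w)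
    {x y : Fin (w 0) → ℝ} (h : x = 0 ∨ y = 0) :
    eNTK L w θ x y = 0 ∧ pNTK L w θ x y = 0 := by
  rcases h with rfl | rfl
  · constructor
    · ext i j
      simp [eNTK, pderiv, fnet_zero hL]
    · simp [pNTK, pderiv, fnet_zero hL]
  · constructor
    · ext i j
      simp [eNTK, pderiv, fnet_zero hL]
    · simp [pNTK, pderiv, fnet_zero hL]

theorem ae_kernels_eq_zero_of_antipodal (hw : ∀ l, 0 < w l) {x y : Fin (w 0) → ℝ} (hx : x ≠ 0)
    (hy : y ≠ 0) {a : ℝ} (ha : 0 < a) (hxy : y = -(a • x)) :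
    ∀ᵐ θ ∂(initMeasure 2 w), eNTK 2 w θ x y = 0 ∧ pNTK 2 w θ x y = 0 := by
  filter_upwards [ae_preactivation_ne_zero (L := 2) hw x, ae_preactivation_ne_zero (L := 2) hw y]
    with θ h1 h2
  have hx' : ∀ l < 1, ∀ i, ∑ j, extParams θ l i j * layerOut w (extParams θ) l x j ≠ 0 := by
    intro l hl
    obtain rfl : l = 0 := by omega
    exact h1 0 (by norm_num) hx
  have hy' : ∀ l < 1, ∀ i, ∑ j, extParams θ l i j * layerOut w (extParams θ) l y j ≠ 0 := by
    intro l hl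
    obtain rfl : l = 0 := by omega
    exact h2 0 (by norm_num) hy
  have hpre : ∀ i, ∑ j, extParams θ 0 i j * y j = -(a * ∑ j, extParams θ 0 i j * x j) := by
    intro i
    rw [hxy, Finset.mul_sum, ← Finset.sum_neg_distrib]
    refine Finset.sum_congr rfl fun j _ => ?_
    simp only [Pi.neg_apply, Pi.smul_apply, smul_eq_mul]
    ring
  have hdot : layerDot w (extParams θ) x y 1 = 0 := by
    refine Finset.sum_eq_zero fun i _ => ?_
    simp only [layerOut, hpre]
    rcases le_total (∑ j, extParams θ 0 i j * x j) 0 with h | h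
    · rw [relu, max_eq_right h, zero_mul]
    · rw [mul_eq_zero]
      exact Or.inr (max_eq_right (by nlinarith))
  have hker : layerKer w (extParams θ) x y 1 = 0 := by
    ext i j
    rw [layerKer_succ, readoutKer]
    by_cases hij : i = j
    · subst hij
      simp only [gate, layerOut, hpre]
      rcases le_total (∑ j, extParams θ 0 i j * x j) 0 with h | h
      · simp [h.not_gt]
      · have : ¬ 0 < -(a * ∑ j, extParams θ 0 i j * x j) := by
          rw [not_lt]
          nlinarith
        simp [this]
    · simp [hij, rowForm, layerKer]
  have hread : ∀ i j, readoutKer w (extParams θ) x y 1 i j = 0 := fun i j => by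
    simp [readoutKer, hdot, hker, rowForm]
  constructor
  · ext i j
    rw [eNTK_eq_readoutKer hx' hy', hread]
    rfl
  · rw [pNTK_eq_sum_readoutKer hx' hy']
    simp [hread]

end Ratio

section Widths

variable {D n O L : ℕ}

theorem widths_pos (hD : 0 < D) (hn : 0 < n) (hO : 0 < O) : ∀ l, 0 < widths D n O L l
  | 0 => hD
  | l + 1 => by
    change 0 < if l + 1 < L then n else O
    split_ifs <;> assumption

theorem widths_of_lt {l : ℕ} (h0 : 1 ≤ l) (hl : l < L) : widths D n O L l = n := by
  obtain ⟨l, rfl⟩ := Nat.exists_eq_add_of_le' h0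
  exact if_pos hl

theorem widths_self (hL : 1 ≤ L) : widths D n O L L = O := by
  obtain ⟨L, rfl⟩ := Nat.exists_eq_add_of_le' hL
  exact if_neg (lt_irrefl _)

end Widths

/-- **Theorem 2 (largest eigenvalue of pNTK ⊗ I_O converges to that of eNTK).**
For a fully-connected ReLU network of depth `L` with hidden widths `n`, He/fan-in
initialization, and fixed inputs `x₁, x₂` in a compact set, for every `δ > 0` there are
`n₀` and a constant `C` such that for all `n > n₀`, with probability at least `1 - δ`
over the random initialization,
`|λ_max(Θ̂ ⊗ I_O) - λ_max(Θ)| / λ_max(Θ) ≤ C n^{-1/2}`. -/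
theorem pNTK_eNTK_lambdaMax_convergence
    (D O L : ℕ) (hD : 0 < D) (hO : 0 < O) (hL : 2 ≤ L)
    (S : Set (Fin D → ℝ)) (hS : IsCompact S)
    (x₁ x₂ : Fin D → ℝ) (hx₁ : x₁ ∈ S) (hx₂ : x₂ ∈ S)
    (δ : ℝ) (hδ : 0 < δ) :
    ∃ (n₀ : ℕ) (C : ℝ), ∀ n : ℕ, n₀ < n →
      ENNReal.ofReal (1 - δ) ≤
        initMeasure L (widths D n O L)
          {θ : Params L (widths D n O L) |
            |lambdaMax (pNTK L (widths D n O L) θ x₁ x₂ •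
                  (1 : Matrix (Fin (widths D n O L L)) (Fin (widths D n O L L)) ℝ)) -
                lambdaMax (eNTK L (widths D n O L) θ x₁ x₂)| /
              lambdaMax (eNTK L (widths D n O L) θ x₁ x₂) ≤ C / Real.sqrt n} := by
  obtain ⟨p, rfl⟩ := Nat.exists_eq_add_of_le' hL
  by_cases h0 : x₁ = 0 ∨ x₂ = 0
  · exact ⟨0, 0, fun n _ => ratio_le_of_ae_eq_zero (w := widths D n O (p + 2)) x₁ x₂ hδ
      (Filter.Eventually.of_forall fun θ => kernels_eq_zero_of_input_eq_zero (by omega) θ h0)⟩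
  obtain ⟨hx, hy⟩ := not_or.1 h0
  have hP : 0 ≤ (∑ k, x₁ k ^ 2) * (∑ k, x₂ k ^ 2) := by positivity
  have hX := sum_sq_pos hx
  have hY := sum_sq_pos hy
  have hD' : (0 : ℝ) < D := by exact_mod_cast hD
  suffices hq : (∃ c : ℝ, 0 < c ∧ ∃ K : ℝ, ∀ n : ℕ, 0 < n →
      initMeasure (p + 2) (widths D n O (p + 2)) {θ | layerDot (widths D n O (p + 2))
        (extParams θ) x₁ x₂ (p + 1) < c * n} ≤ ENNReal.ofReal (K / n)) ∨
      (p = 0 ∧ ∃ a : ℝ, 0 < a ∧ x₂ = -(a • x₁)) by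
    rcases hq with ⟨c, hc, K, hK⟩ | ⟨rfl, a, ha, hxy⟩
    · obtain ⟨n₀, C, h⟩ := exists_ratio_le hP (∑ k, x₁ k * x₂ k) hO p (K := K) hc hδ
      exact ⟨n₀, C, fun n hn => h n (widths D n O (p + 2)) hn (widths_pos hD (by omega) hO)
        (fun l h0 hl => widths_of_lt h0 hl) (widths_self (by omega)) x₁ x₂ rfl rfl
        (hK n (by omega))⟩
    · exact ⟨0, 0, fun n hn => ratio_le_of_ae_eq_zero (w := widths D n O 2) x₁ x₂ hδ
        (ae_kernels_eq_zero_of_antipodal (w := widths D n O 2)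
          (widths_pos hD hn hO) hx hy ha hxy)⟩
  rcases Nat.eq_zero_or_pos p with rfl | hp
  · by_cases hanti : ∃ a : ℝ, 0 < a ∧ x₂ = -(a • x₁)
    · exact Or.inr ⟨rfl, hanti⟩
    · obtain ⟨u, hux, huy⟩ := exists_pos_of_not_antipodal hx hy
        fun a ha h => hanti ⟨a, ha, h⟩
      have hk := reluCov_pos (v := (D : NNReal)⁻¹) (by simpa using hD.ne') hux huy
      exact Or.inl ⟨reluCov (D : NNReal)⁻¹ x₁ x₂ / 2, by positivity, 12 *
        (((D : NNReal)⁻¹ : NNReal) ^ 2 * ((∑ k, x₁ k ^ 2) * (∑ k, x₂ k ^ 2))) /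
        reluCov (D : NNReal)⁻¹ x₁ x₂ ^ 2, fun n hn =>
        measure_layerDot_one_lt_le (w := widths D n O 2) hn (by norm_num)
          (widths_of_lt le_rfl (by norm_num)) x₁ x₂ hk le_rfl⟩
  · exact Or.inl ⟨Real.sqrt ((1 / 1024) ^ p * (∑ k, x₁ k ^ 2) *
      ((1 / 1024) ^ p * (∑ k, x₂ k ^ 2))) / D / 1024, by positivity, (2 * p + 1) * (12 * 512 ^ 2), fun n hn =>
      measure_layerDot_lt_le (w := widths D n O (p + 2)) hn (widths_pos hD hn hO) hp
        (fun l h0 hl => widths_of_lt h0 hl) x₁ x₂⟩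

end
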